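/- arXiv:2509.13153 — 3 statements merged into one kernel-verified Lean document; each statement's English description precedes it below -/
import Mathlib

section
/- Let p, q, r be distinct odd primes with pqr ≡ 1 (mod 4) and exactly two of p, q, r congruent to 3 mod 4. Then 8 divides the class number of ℚ(√(-pqr)). -/
open NumberField
open scoped nonZeroDivisors

/-- Three elements killed by `2` and independent over `ZMod 2` generate a subgroup of order `8`. -/
theorem eight_dvd_card_of_independent {G : Type*} [AddCommGroup G] {a b c : G}
    (ha : 2 • a = 0) (hb : 2 • b = 0) (hc : 2 • c = 0)
    (h : ∀ i j k : Fin 2, (i : ℕ) • a + (j : ℕ) • b + (k : ℕ) • c = 0 → i = 0 ∧ j = 0 ∧ k = 0) :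
    8 ∣ Nat.card G := by
  have lift (x : G) (hx : 2 • x = 0) : ∃ f : ZMod 2 →+ G, ∀ i : ZMod 2, f i = i.val • x := by
    refine ⟨ZMod.lift 2 ⟨zmultiplesHom G x, (natCast_zsmul x 2).trans hx⟩, fun i ↦ ?_⟩
    have hi : i = ((i.val : ℤ) : ZMod 2) := by simp
    exact (congrArg _ hi).trans ((ZMod.lift_coe 2 _ _).trans (natCast_zsmul x _))
  obtain ⟨f, hf⟩ := lift a ha
  obtain ⟨g, hg⟩ := lift b hb
  obtain ⟨k, hk⟩ := lift c hc
  have hinj : Function.Injective ((f.coprod g).coprod k) := by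
    rw [injective_iff_map_eq_zero]
    rintro ⟨⟨x, y⟩, z⟩ hxyz
    simp only [AddMonoidHom.coprod_apply, hf, hg, hk] at hxyz
    obtain ⟨rfl, rfl, rfl⟩ := h x y z hxyz
    rfl
  simpa using AddSubgroup.card_dvd_of_injective _ hinj

/-- If `N ≡ 1 (mod 4)` is squarefree, then half-integral solutions of `x² + N y² = d` are
integral. -/
theorem exists_sq_add_mul_sq_eq {N t d : ℤ} {s : ℚ} (hsf : Squarefree N) (hN : N % 4 = 1)
    (h : (4 * d : ℚ) = t ^ 2 + N * s ^ 2) : ∃ a b : ℤ, a ^ 2 + N * b ^ 2 = d := by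
  have hN0 : (N : ℚ) ≠ 0 := by exact_mod_cast hsf.ne_zero
  have hint : IsIntegral ℤ (N * s) := by
    refine IsIntegral.of_pow (n := 2) two_pos ?_
    have : (N * s) ^ 2 = ((N * (4 * d - t ^ 2) : ℤ) : ℚ) := by
      push_cast
      rw [h]
      ring
    rw [this]
    exact isIntegral_algebraMap (R := ℤ) (A := ℚ)
  obtain ⟨k, hk⟩ := IsIntegrallyClosed.isIntegral_iff.1 hint
  simp only [algebraMap_int_eq, eq_intCast] at hk
  have hk2 : k ^ 2 = N * (4 * d - t ^ 2) := by
    have : (k : ℚ) ^ 2 = N * (4 * d - t ^ 2) := by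
      rw [hk, h]
      ring
    exact_mod_cast this
  obtain ⟨m, rfl⟩ := (hsf.dvd_pow_iff_dvd two_ne_zero).1 (Dvd.intro _ hk2.symm)
  have hm : N * m ^ 2 = 4 * d - t ^ 2 := by
    apply mul_left_cancel₀ hsf.ne_zero
    rw [← hk2]
    ring
  have hmod : (t ^ 2 + N * m ^ 2) % 4 = 0 := by
    rw [hm]
    ring_nf
    omega
  have hev : t % 2 = 0 ∧ m % 2 = 0 := by
    obtain ⟨n, hn⟩ : ∃ n, N = 4 * n + 1 := ⟨N / 4, by omega⟩
    rcases Int.even_or_odd' t with ⟨u, rfl | rfl⟩ <;>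
    rcases Int.even_or_odd' m with ⟨v, rfl | rfl⟩ <;>
    · subst hn
      ring_nf at hmod
      omega
  obtain ⟨u, rfl⟩ := Int.dvd_of_emod_eq_zero hev.1
  obtain ⟨v, rfl⟩ := Int.dvd_of_emod_eq_zero hev.2
  exact ⟨u, v, by linarith⟩

theorem not_sq_add_mul_sq_eq {N d : ℕ} (hd : Squarefree d) (hd1 : d ≠ 1) (hlt : d < N) (a b : ℤ) :
    a ^ 2 + N * b ^ 2 ≠ d := by
  intro h
  rcases eq_or_ne b 0 with rfl | hb
  · have h' : a.natAbs * a.natAbs = d := by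
      zify
      rw [← h, ← sq, sq_abs]
      ring
    have hu := hd a.natAbs (Dvd.intro _ (by rw [h', mul_one]))
    rw [Nat.isUnit_iff.1 hu] at h'
    exact hd1 h'.symm
  · have : 0 < b ^ 2 := by positivity
    zify at hlt
    nlinarith [sq_nonneg a]

section Quadratic

variable {F : Type*} [Field F] [NumberField F] {N : ℕ} {α : F}

/-- Norm and trace of an element of `ℚ(√-N)` in coordinates. -/
theorem exists_trace_norm_eq (hdeg : Module.finrank ℚ F = 2) (hN : N ≠ 0) (hα : α ^ 2 = -(N : F))
    (β : F) : ∃ x y : ℚ,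
      Algebra.trace ℚ F β = 2 * x ∧ Algebra.norm ℚ β = x ^ 2 + N * y ^ 2 := by
  have hli : LinearIndependent ℚ ![1, α] := by
    rw [LinearIndependent.pair_iff' one_ne_zero]
    rintro a rfl
    have : ((a ^ 2 : ℚ) : F) = ((-N : ℚ) : F) := by
      push_cast
      rw [← hα, Rat.smul_def, mul_one]
    have h2 : a ^ 2 = -(N : ℚ) := by exact_mod_cast this
    have h3 : (0 : ℚ) < N := by positivity
    nlinarith [sq_nonneg a]
  let b := basisOfLinearIndependentOfCardEqFinrank hli (by simp [hdeg])
  have hb0 : b 0 = 1 := by simp [b]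
  have hb1 : b 1 = α := by simp [b]
  obtain ⟨x, y, hxy⟩ : ∃ x y : ℚ, β = x • b 0 + y • b 1 :=
    ⟨b.repr β 0, b.repr β 1, by rw [← Fin.sum_univ_two fun i ↦ b.repr β i • b i, b.sum_repr]⟩
  have h0 : β * b 0 = x • b 0 + y • b 1 := by rw [← hxy, hb0, mul_one]
  have h1 : β * b 1 = (-N * y) • b 0 + x • b 1 := by
    rw [hxy, hb0, hb1]
    simp only [Rat.smul_def]
    push_cast
    linear_combination (y : F) * hα
  refine ⟨x, y, ?_, ?_⟩
  · rw [Algebra.trace_eq_matrix_trace b, Matrix.trace_fin_two]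
    simp only [Algebra.leftMulMatrix_eq_repr_mul, h0, h1]
    simp
    ring
  · rw [Algebra.norm_eq_matrix_det b, Matrix.det_fin_two]
    simp only [Algebra.leftMulMatrix_eq_repr_mul, h0, h1]
    simp
    ring

/-- In `ℚ(√-N)` with `N ≡ 1 (mod 4)` squarefree, an ideal with square `(d)` is not principal
when `1 < d < N` is squarefree. -/
theorem not_isPrincipal_of_sq_eq_span (hdeg : Module.finrank ℚ F = 2) (hsf : Squarefree N)
    (hN : N % 4 = 1) (hα : α ^ 2 = -(N : F)) {d : ℕ} (hd : Squarefree d) (hd1 : d ≠ 1)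
    (hlt : d < N) {I : Ideal (𝓞 F)} (hI : I ^ 2 = Ideal.span {(d : 𝓞 F)}) :
    ¬ I.IsPrincipal := by
  rintro ⟨β, rfl⟩
  rw [Ideal.submodule_span_eq, Ideal.span_singleton_pow, Ideal.span_singleton_eq_span_singleton]
    at hI
  obtain ⟨u, hu⟩ := hI
  obtain ⟨x, y, htr, hnorm⟩ := exists_trace_norm_eq hdeg hsf.ne_zero hα (β : F)
  obtain ⟨t, ht⟩ := IsIntegrallyClosed.isIntegral_iff.1
    (Algebra.isIntegral_trace (L := ℚ) (RingOfIntegers.isIntegral_coe β))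
  have hunit := isUnit_iff_norm.1 u.isUnit
  rw [RingOfIntegers.coe_norm] at hunit
  have hsq : Algebra.norm ℚ (β : F) ^ 2 = (d : ℚ) ^ 2 := by
    have := congrArg (fun z : 𝓞 F ↦ |Algebra.norm ℚ (z : F)|) hu
    simp only [map_mul, map_pow, abs_mul, hunit, mul_one, map_natCast, Algebra.norm_natCast,
      hdeg] at this
    simpa [abs_pow, sq_abs] using this
  have hnd : Algebra.norm ℚ (β : F) = d := by
    refine (pow_left_inj₀ ?_ (Nat.cast_nonneg d) two_ne_zero).1 hsq
    rw [hnorm]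
    positivity
  simp only [algebraMap_int_eq, eq_intCast] at ht
  obtain ⟨a, b, hab⟩ := exists_sq_add_mul_sq_eq (N := (N : ℤ)) (t := t) (d := d) (s := 2 * y)
    (Int.squarefree_natCast.2 hsf) (by omega) (by
      push_cast
      rw [ht, htr, ← hnd, hnorm]
      ring)
  exact not_sq_add_mul_sq_eq hd hd1 hlt a b hab

end Quadratic

/-- A ramified prime divisor `d` of `N = d * m`, with `m` prime to `d`, gives an ideal of
square `(d)`. -/
theorem span_pair_sq_eq_of_isCoprime {R : Type*} [CommRing R] {a d m : R} (ha : a ^ 2 = -(d * m))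
    (hdm : IsCoprime d m) : Ideal.span {d, a} ^ 2 = Ideal.span {d} := by
  obtain ⟨u, v, huv⟩ := hdm
  rw [sq, Ideal.span_pair_mul_span_pair]
  apply le_antisymm
  · rw [Ideal.span_le]
    rintro z (rfl | rfl | rfl | rfl)
    all_goals rw [SetLike.mem_coe, Ideal.mem_span_singleton]
    · exact dvd_mul_right _ _
    · exact dvd_mul_right _ _
    · exact dvd_mul_left _ _
    · exact ⟨-m, by linear_combination ha⟩
  · rw [Ideal.span_singleton_le_iff_mem]
    have h1 : d * d ∈ Ideal.span {d * d, d * a, a * d, a * a} := Ideal.subset_span (by simp)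
    have h2 : a * a ∈ Ideal.span {d * d, d * a, a * d, a * a} := Ideal.subset_span (by simp)
    convert sub_mem (Ideal.mul_mem_left _ u h1) (Ideal.mul_mem_left _ v h2) using 1
    linear_combination (-d) * huv + v * ha

theorem span_two_pair_sq_eq {R : Type*} [CommRing R] {a n : R} (ha : a ^ 2 = -(4 * n + 1)) :
    Ideal.span {2, 1 + a} ^ 2 = Ideal.span {(2 : R)} := by
  rw [sq, Ideal.span_pair_mul_span_pair]
  apply le_antisymm
  · rw [Ideal.span_le]
    rintro z (rfl | rfl | rfl | rfl)
    all_goals rw [SetLike.mem_coe, Ideal.mem_span_singleton]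
    · exact dvd_mul_right _ _
    · exact dvd_mul_right _ _
    · exact dvd_mul_left _ _
    · exact ⟨a - 2 * n, by linear_combination ha⟩
  · rw [Ideal.span_singleton_le_iff_mem]
    set J := Ideal.span {2 * 2, 2 * (1 + a), (1 + a) * 2, (1 + a) * (1 + a)}
    have h1 : 2 * 2 ∈ J := Ideal.subset_span (by simp)
    have h2 : 2 * (1 + a) ∈ J := Ideal.subset_span (by simp)
    have h3 : (1 + a) * (1 + a) ∈ J := Ideal.subset_span (by simp)
    convert sub_mem (sub_mem h2 h3) (Ideal.mul_mem_left _ n h1) using 1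
    linear_combination ha

theorem mk0_sq_eq_one_of_sq_eq_span {R : Type*} [CommRing R] [IsDedekindDomain R]
    {I : (Ideal R)⁰} {x : R} (h : (I : Ideal R) ^ 2 = Ideal.span {x}) :
    ClassGroup.mk0 I ^ 2 = 1 := by
  have hx : x ≠ 0 := by
    rintro rfl
    refine pow_ne_zero 2 (nonZeroDivisors.coe_ne_zero I) (h.trans ?_)
    rw [Ideal.span_singleton_eq_bot.2 rfl, Ideal.zero_eq_bot]
  rw [sq, mul_eq_one_iff_eq_inv, ClassGroup.mk0_eq_mk0_inv_iff]
  exact ⟨x, hx, by rw [← h, sq]⟩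

/-- If `p, q, r` are distinct odd primes with `p q r ≡ 1 (mod 4)` and exactly two of
them congruent to `3` mod `4`, then `8` divides the class number of `ℚ(√(-p q r))`. -/
theorem eight_dvd_classNumber (p q r : ℕ) (hp : p.Prime) (hq : q.Prime) (hr : r.Prime)
    (hp2 : p ≠ 2) (hq2 : q ≠ 2) (hr2 : r ≠ 2)
    (hpq : p ≠ q) (hpr : p ≠ r) (hqr : q ≠ r)
    (hmod : (p * q * r) % 4 = 1)
    (htwo : (({p, q, r} : Finset ℕ).filter (fun n => n % 4 = 3)).card = 2)
    (F : Type) [Field F] [NumberField F] (hdeg : Module.finrank ℚ F = 2)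
    (hgen : ∃ α : F, α ^ 2 = -((p : F) * q * r)) :
    8 ∣ NumberField.classNumber F := by
  obtain ⟨α, hα⟩ := hgen
  have cpq := (Nat.coprime_primes hp hq).2 hpq
  have cpr := (Nat.coprime_primes hp hr).2 hpr
  have cqr := (Nat.coprime_primes hq hr).2 hqr
  have c2p := (Nat.coprime_primes Nat.prime_two hp).2 hp2.symm
  have c2q := (Nat.coprime_primes Nat.prime_two hq).2 hq2.symm
  have hsf : Squarefree (p * q * r) :=
    (Nat.squarefree_mul (Nat.Coprime.mul_left cpr cqr)).2
      ⟨(Nat.squarefree_mul cpq).2 ⟨hp.squarefree, hq.squarefree⟩, hr.squarefree⟩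
  have hαN : α ^ 2 = -((p * q * r : ℕ) : F) := by
    push_cast
    exact hα
  have hint : IsIntegral ℤ α := by
    refine IsIntegral.of_pow (n := 2) two_pos ?_
    rw [hαN]
    exact (isIntegral_natCast _).neg
  obtain ⟨a, ha'⟩ : ∃ a : 𝓞 F, (a : F) = α := ⟨⟨α, hint⟩, rfl⟩
  have ha : a ^ 2 = -((p : 𝓞 F) * q * r) := by
    apply RingOfIntegers.ext
    simpa [ha'] using hα
  have cop {m n : ℕ} (h : m.Coprime n) : IsCoprime (m : 𝓞 F) (n : 𝓞 F) := h.cast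
  have hI2 : Ideal.span {2, 1 + a} ^ 2 = Ideal.span {((2 : ℕ) : 𝓞 F)} := by
    obtain ⟨n, hn⟩ : ∃ n, p * q * r = 4 * n + 1 := ⟨p * q * r / 4, by omega⟩
    have hn' : (p : 𝓞 F) * q * r = 4 * (n : 𝓞 F) + 1 := by
      exact_mod_cast congrArg (Nat.cast (R := 𝓞 F)) hn
    rw [hn'] at ha
    exact_mod_cast span_two_pair_sq_eq ha
  have hIp : Ideal.span {(p : 𝓞 F), a} ^ 2 = Ideal.span {(p : 𝓞 F)} :=
    span_pair_sq_eq_of_isCoprime (m := (q : 𝓞 F) * r) (by rw [ha]; ring)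
      ((cop cpq).mul_right (cop cpr))
  have hIq : Ideal.span {(q : 𝓞 F), a} ^ 2 = Ideal.span {(q : 𝓞 F)} :=
    span_pair_sq_eq_of_isCoprime (m := (p : 𝓞 F) * r) (by rw [ha]; ring)
      ((cop cpq.symm).mul_right (cop cqr))
  have mem {I : Ideal (𝓞 F)} {d : ℕ} (hd : d ≠ 0) (h : I ^ 2 = Ideal.span {(d : 𝓞 F)}) :
      I ∈ (Ideal (𝓞 F))⁰ := by
    rw [mem_nonZeroDivisors_iff_ne_zero]
    rintro rfl
    rw [zero_pow two_ne_zero, eq_comm, Ideal.zero_eq_bot, Ideal.span_singleton_eq_bot] at h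
    exact hd (by exact_mod_cast h)
  let I2 : (Ideal (𝓞 F))⁰ := ⟨_, mem two_ne_zero hI2⟩
  let Ip : (Ideal (𝓞 F))⁰ := ⟨_, mem hp.ne_zero hIp⟩
  let Iq : (Ideal (𝓞 F))⁰ := ⟨_, mem hq.ne_zero hIq⟩
  rw [NumberField.classNumber, ← Nat.card_eq_fintype_card]
  change 8 ∣ Nat.card (Additive (ClassGroup (𝓞 F)))
  refine eight_dvd_card_of_independent (a := Additive.ofMul (ClassGroup.mk0 I2))
    (b := Additive.ofMul (ClassGroup.mk0 Ip)) (c := Additive.ofMul (ClassGroup.mk0 Iq))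
    (congrArg Additive.ofMul (mk0_sq_eq_one_of_sq_eq_span (I := I2) hI2))
    (congrArg Additive.ofMul (mk0_sq_eq_one_of_sq_eq_span (I := Ip) hIp))
    (congrArg Additive.ofMul (mk0_sq_eq_one_of_sq_eq_span (I := Iq) hIq)) fun i j k h ↦ ?_
  replace h : ClassGroup.mk0 I2 ^ (i : ℕ) * ClassGroup.mk0 Ip ^ (j : ℕ) *
    ClassGroup.mk0 Iq ^ (k : ℕ) = 1 := h
  rw [← map_pow, ← map_pow, ← map_pow, ← map_mul, ← map_mul] at h
  have hprin := (ClassGroup.mk0_eq_one_iff (I2 ^ (i : ℕ) * Ip ^ (j : ℕ) * Iq ^ (k : ℕ)).2).1 h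
  have hsq : ((I2 ^ (i : ℕ) * Ip ^ (j : ℕ) * Iq ^ (k : ℕ) : (Ideal (𝓞 F))⁰) : Ideal (𝓞 F)) ^ 2 =
      Ideal.span {((2 ^ (i : ℕ) * p ^ (j : ℕ) * q ^ (k : ℕ) : ℕ) : 𝓞 F)} := by
    push_cast
    rw [mul_pow, mul_pow, ← pow_mul, ← pow_mul, ← pow_mul, mul_comm _ 2, mul_comm _ 2,
      mul_comm _ 2, pow_mul, pow_mul, pow_mul, hI2, hIp, hIq]
    simp only [Ideal.span_singleton_pow, Ideal.span_singleton_mul_span_singleton, Nat.cast_ofNat]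
  by_contra hne
  have hpow {n : ℕ} (hn : n.Prime) (l : Fin 2) : Squarefree (n ^ (l : ℕ)) ∧ n ^ (l : ℕ) ≤ n ∧
      (n ^ (l : ℕ) = 1 → l = 0) := by
    fin_cases l
    · simpa using hn.one_le
    · simpa using ⟨hn.squarefree, hn.ne_one⟩
  obtain ⟨s2, l2, e2⟩ := hpow Nat.prime_two i
  obtain ⟨sp, lp, ep⟩ := hpow hp j
  obtain ⟨sq, lq, eq⟩ := hpow hq k
  refine not_isPrincipal_of_sq_eq_span hdeg hsf hmod hαN ?_ ?_ ?_ hsq hprin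
  · refine (Nat.squarefree_mul ?_).2 ⟨(Nat.squarefree_mul ?_).2 ⟨s2, sp⟩, sq⟩
    · exact (c2q.pow _ _).mul_left (cpq.pow _ _)
    · exact c2p.pow _ _
  · intro h1
    rw [mul_eq_one, mul_eq_one] at h1
    exact hne ⟨e2 h1.1.1, ep h1.1.2, eq h1.2⟩
  · have hr3 : 2 < r := lt_of_le_of_ne hr.two_le hr2.symm
    have hpos : 0 < p * q := Nat.mul_pos hp.pos hq.pos
    calc 2 ^ (i : ℕ) * p ^ (j : ℕ) * q ^ (k : ℕ) ≤ 2 * p * q := by gcongr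
      _ = p * q * 2 := by ring
      _ < p * q * r := by gcongr
end

section
/- Let p, q, r be distinct primes all congruent to 1 mod 4. Then 4 divides the class number of the real quadratic field ℚ(√(pqr)). -/
open NumberField nonZeroDivisors

/-- `x` is a square up to sign. -/
def IsSquareUpToSign {F : Type*} [Field F] (x : F) : Prop := IsSquare x ∨ IsSquare (-x)

namespace IsSquareUpToSign

variable {F : Type*} [Field F] {x y z : F}

lemma mul (hx : IsSquareUpToSign x) (hy : IsSquareUpToSign y) : IsSquareUpToSign (x * y) := by
  rcases hx with hx | hx <;> rcases hy with hy | hy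
  · exact Or.inl (hx.mul hy)
  · exact Or.inr (by simpa using hx.mul hy)
  · exact Or.inr (by simpa using hx.mul hy)
  · exact Or.inl (by simpa using hx.mul hy)

lemma of_sq_mul (hy : y ≠ 0) (h : IsSquareUpToSign (y ^ 2 * x)) : IsSquareUpToSign x := by
  have h2 : IsSquare ((y⁻¹) ^ 2) := IsSquare.sq _
  have := mul (Or.inl h2) h
  rwa [← mul_assoc, ← mul_pow, inv_mul_cancel₀ hy, one_pow, one_mul] at this

lemma of_mul_mul (hy : y ≠ 0) (h₁ : IsSquareUpToSign (y * x)) (h₂ : IsSquareUpToSign (y * z)) :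
    IsSquareUpToSign (x * z) := by
  refine of_sq_mul hy ?_
  convert h₁.mul h₂ using 1
  ring

end IsSquareUpToSign

/-- If `-1` is not a square, roots of unity are squares up to sign. -/
lemma isSquareUpToSign_of_mem_torsion {F : Type*} [Field F] [NumberField F]
    (hneg : ¬ IsSquare (-1 : F)) (t : Units.torsion F) :
    IsSquareUpToSign (((t : (𝓞 F)ˣ) : 𝓞 F) : F) := by
  obtain ⟨ζ, hζ⟩ := IsCyclic.exists_generator (α := Units.torsion F)
  have even_isSquare (n : ℤ) (hn : Even n) :
      IsSquare ((((ζ ^ n : Units.torsion F) : (𝓞 F)ˣ) : 𝓞 F) : F) := by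
    obtain ⟨k, rfl⟩ := hn
    exact ⟨((((ζ ^ k : Units.torsion F) : (𝓞 F)ˣ) : 𝓞 F) : F), by simp [zpow_add]⟩
  have hmem : (-1 : (𝓞 F)ˣ) ∈ Units.torsion F := by
    rw [Units.torsion, CommGroup.mem_torsion]
    exact isOfFinOrder_iff_pow_eq_one.mpr ⟨2, by norm_num, by simp⟩
  obtain ⟨k, hk⟩ := Subgroup.mem_zpowers_iff.mp (hζ ⟨-1, hmem⟩)
  obtain ⟨m, rfl⟩ := Subgroup.mem_zpowers_iff.mp (hζ t)
  have hkodd : Odd k := by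
    by_contra hodd
    have := even_isSquare k (Int.not_odd_iff_even.mp hodd)
    rw [hk] at this
    exact hneg (by simpa using this)
  by_cases hm : Even m
  · exact Or.inl (even_isSquare m hm)
  · right
    have := even_isSquare (k + m) (hkodd.add_odd (Int.not_even_iff_odd.mp hm))
    rw [zpow_add, hk] at this
    simpa using this

lemma rank_le_one_of_finrank_eq_two {F : Type*} [Field F] [NumberField F]
    (hdeg : Module.finrank ℚ F = 2) : Units.rank F ≤ 1 := by
  have h₁ := InfinitePlace.card_add_two_mul_card_eq_rank F
  have h₂ := InfinitePlace.card_eq_nrRealPlaces_add_nrComplexPlaces F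
  rw [Units.rank]
  omega

lemma exists_unit_isSquareUpToSign {F : Type*} [Field F] [NumberField F]
    (hneg : ¬ IsSquare (-1 : F)) (hrank : Units.rank F ≤ 1) :
    ∃ η : (𝓞 F)ˣ, ∀ u : (𝓞 F)ˣ, IsSquareUpToSign ((u : 𝓞 F) : F) ∨
      IsSquareUpToSign (((η : 𝓞 F) : F) * ((u : 𝓞 F) : F)) := by
  obtain ⟨η, hη⟩ : ∃ η : (𝓞 F)ˣ, ∀ u : (𝓞 F)ˣ, ∃ (t : Units.torsion F) (k : ℤ),
      u = t * η ^ k := by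
    by_cases h0 : Units.rank F = 0
    · refine ⟨1, fun u ↦ ?_⟩
      obtain ⟨⟨t, e⟩, h, -⟩ := Units.exist_unique_eq_mul_prod F u
      have : IsEmpty (Fin (Units.rank F)) := by rw [h0]; infer_instance
      exact ⟨t, 0, by simpa using h⟩
    · have : Unique (Fin (Units.rank F)) := by
        rw [show Units.rank F = 1 by omega]; infer_instance
      refine ⟨Units.fundSystem F default, fun u ↦ ?_⟩
      obtain ⟨⟨t, e⟩, h, -⟩ := Units.exist_unique_eq_mul_prod F u
      exact ⟨t, e default, by simpa using h⟩
  refine ⟨η, fun u ↦ ?_⟩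
  obtain ⟨t, k, rfl⟩ := hη u
  have ht := isSquareUpToSign_of_mem_torsion hneg t
  have even_isSquare (n : ℤ) (hn : Even n) : IsSquareUpToSign (((η ^ n : (𝓞 F)ˣ) : 𝓞 F) : F) := by
    obtain ⟨k, rfl⟩ := hn
    exact Or.inl ⟨(((η ^ k : (𝓞 F)ˣ) : 𝓞 F) : F), by simp [zpow_add]⟩
  by_cases hk : Even k
  · left
    simpa using ht.mul (even_isSquare k hk)
  · right
    have := ht.mul (even_isSquare (1 + k) (odd_one.add_odd (Int.not_even_iff_odd.mp hk)))
    rw [zpow_add, zpow_one] at this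
    convert this using 1
    push_cast
    ring

lemma exists_unit_of_mk0_eq {F : Type*} [Field F] [NumberField F] {I J : (Ideal (𝓞 F))⁰}
    {s t : 𝓞 F} (hI : (I : Ideal (𝓞 F)) ^ 2 = Ideal.span {s})
    (hJ : (J : Ideal (𝓞 F)) ^ 2 = Ideal.span {t}) (h : ClassGroup.mk0 I = ClassGroup.mk0 J) :
    ∃ u : (𝓞 F)ˣ, IsSquareUpToSign (((u : 𝓞 F) : F) * (s * t : 𝓞 F)) := by
  obtain ⟨x, y, hx, hy, hxy⟩ := ClassGroup.mk0_eq_mk0_iff.mp h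
  have hsq := congrArg (· ^ 2) hxy
  simp only [mul_pow, hI, hJ, Ideal.span_singleton_pow, Ideal.span_singleton_mul_span_singleton,
    Ideal.span_singleton_eq_span_singleton] at hsq
  obtain ⟨u, hu⟩ := hsq
  refine ⟨u, IsSquareUpToSign.of_sq_mul (y := (x : F)) (by simpa using hx) (Or.inl ?_)⟩
  refine ⟨((y * t : 𝓞 F) : F), ?_⟩
  rw [← map_pow, ← map_mul, ← map_mul, ← map_mul]
  congr 1
  linear_combination t * hu

/-- If the units modulo squares and signs have at most two classes, eight squares of ideals with
generators independent up to sign and squares force `4` to divide the class number. -/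
lemma four_dvd_classNumber_of_independent {F : Type*} [Field F] [NumberField F]
    (hneg : ¬ IsSquare (-1 : F)) (hrank : Units.rank F ≤ 1) {ι : Type*} [Fintype ι]
    (hι : 8 ≤ Fintype.card ι) (s : ι → 𝓞 F) (I : ι → Ideal (𝓞 F)) (hs : ∀ i, s i ≠ 0)
    (hI : ∀ i, I i ^ 2 = Ideal.span {s i})
    (hind : ∀ i j, IsSquareUpToSign ((s i * s j : 𝓞 F) : F) → i = j) :
    4 ∣ classNumber F := by
  classical
  have hI0 (i) : I i ∈ (Ideal (𝓞 F))⁰ := by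
    refine mem_nonZeroDivisors_of_ne_zero fun h ↦ hs i ?_
    have := hI i
    rw [h, zero_pow two_ne_zero] at this
    simpa using this.symm
  let f : ι → ClassGroup (𝓞 F) := fun i ↦ ClassGroup.mk0 ⟨I i, hI0 i⟩
  obtain ⟨η, hη⟩ := exists_unit_isSquareUpToSign hneg hrank
  have key (i j) (hij : i ≠ j) (h : f i = f j) :
      IsSquareUpToSign (((η : 𝓞 F) : F) * (s i * s j : 𝓞 F)) := by
    obtain ⟨u, hu⟩ := exists_unit_of_mk0_eq (I := ⟨I i, hI0 i⟩) (J := ⟨I j, hI0 j⟩)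
      (hI i) (hI j) h
    have hu0 : ((u : 𝓞 F) : F) ≠ 0 := by simp
    rcases hη u with h' | h'
    · refine absurd (hind i j ?_) hij
      simpa using IsSquareUpToSign.of_mul_mul (x := 1) hu0 (by simpa using h') hu
    · exact IsSquareUpToSign.of_mul_mul hu0 (by rwa [mul_comm]) hu
  have hcard : 4 ≤ (Finset.univ.image f).card := by
    have := Finset.card_le_mul_card_image (f := f) Finset.univ 2 fun b _ ↦ by
      by_contra! hb
      obtain ⟨i, hi, j, hj, k, hk, hij, hik, hjk⟩ := Finset.two_lt_card.mp hb
      simp only [Finset.mem_filter, Finset.mem_univ, true_and] at hi hj hk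
      refine hjk (hind j k (IsSquareUpToSign.of_sq_mul (y := ((s i : 𝓞 F) : F))
        (by simpa using hs i) ?_))
      have := IsSquareUpToSign.of_mul_mul (by simp) (key i j hij (hi.trans hj.symm))
        (key i k hik (hi.trans hk.symm))
      convert this using 1
      push_cast
      ring
    rw [Finset.card_univ] at this
    omega
  let H : Subgroup (ClassGroup (𝓞 F)) := (powMonoidHom 2).ker
  have hf (i) : f i ∈ H := by
    rw [MonoidHom.mem_ker, powMonoidHom_apply, ← map_pow, ClassGroup.mk0_eq_one_iff]
    change (I i ^ 2).IsPrincipal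
    rw [hI i]
    exact ⟨s i, rfl⟩
  have : Fact (Nat.Prime 2) := ⟨Nat.prime_two⟩
  have hH : IsPGroup 2 H := fun g ↦ ⟨1, by
    have := g.2
    rw [MonoidHom.mem_ker, powMonoidHom_apply] at this
    ext
    simpa using this⟩
  obtain ⟨n, hn⟩ := IsPGroup.iff_card.mp hH
  have hle : 4 ≤ Nat.card H := by
    refine hcard.trans ?_
    rw [← Set.ncard_coe_finset, ← Nat.card_coe_set_eq]
    refine Nat.card_mono (Set.toFinite _) ?_
    intro x hx
    obtain ⟨i, -, rfl⟩ := Finset.mem_image.mp hx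
    exact hf i
  have hn2 : 2 ≤ n := by
    by_contra! hlt
    interval_cases n <;> omega
  have hdvd : 4 ∣ Nat.card H := hn ▸ pow_dvd_pow 2 hn2
  rw [classNumber, ← Nat.card_eq_fintype_card]
  exact hdvd.trans (Subgroup.card_subgroup_dvd_card H)

lemma span_pair_sq_of_isCoprime {R : Type*} [CommRing R] {x y z : R} (hxz : IsCoprime x z)
    (h : y ^ 2 = x * z) : Ideal.span {x, y} ^ 2 = Ideal.span {x} := by
  obtain ⟨a, b, hab⟩ := hxz
  rw [sq, Ideal.span_pair_mul_span_pair]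
  apply le_antisymm
  · rw [Ideal.span_le]
    rintro w (rfl | rfl | rfl | rfl) <;> rw [SetLike.mem_coe, Ideal.mem_span_singleton]
    · exact Dvd.intro _ rfl
    · exact Dvd.intro _ rfl
    · exact Dvd.intro_left _ rfl
    · exact ⟨z, by rw [← h, sq]⟩
  · rw [Ideal.span_singleton_le_iff_mem]
    have hx : a * (x * x) + b * (y * y) = x := by linear_combination x * hab + b * h
    have hmem : a * (x * x) + b * (y * y) ∈ Ideal.span {x * x, x * y, y * x, y * y} :=
      Ideal.add_mem _ (Ideal.mul_mem_left _ _ (Ideal.subset_span (by simp)))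
        (Ideal.mul_mem_left _ _ (Ideal.subset_span (by simp)))
    rwa [hx] at hmem

lemma exists_eq_add_mul_sqrt {F : Type*} [Field F] [NumberField F]
    (hdeg : Module.finrank ℚ F = 2) {d : ℕ} (hd : ¬ IsSquare d) {α : F} (hα : α ^ 2 = d) :
    (∀ u v : ℚ, (u : F) + v * α = 0 → u = 0 ∧ v = 0) ∧ ∀ w : F, ∃ u v : ℚ, w = u + v * α := by
  have hirr (u : ℚ) : (u : F) ≠ α := by
    rintro rfl
    refine hd (Rat.isSquare_natCast_iff.mp ⟨u, ?_⟩)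
    rw [← sq]
    exact_mod_cast hα.symm
  have hind (u v : ℚ) (h : (u : F) + v * α = 0) : u = 0 ∧ v = 0 := by
    have hv : v = 0 := by
      by_contra hv
      have hv' : (v : F) ≠ 0 := by exact_mod_cast hv
      refine hirr (-u / v) ?_
      push_cast
      field_simp
      linear_combination -h
    subst hv
    simpa using h
  refine ⟨hind, fun w ↦ ?_⟩
  have hli : LinearIndependent ℚ ![(1 : F), α] := by
    rw [LinearIndependent.pair_iff]
    intro u v h
    exact hind u v (by simpa [Rat.smul_def] using h)
  have hspan := hli.span_eq_top_of_card_eq_finrank (by simp [hdeg])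
  have hw : w ∈ Submodule.span ℚ (Set.range ![(1 : F), α]) := hspan ▸ Submodule.mem_top
  rw [Matrix.range_cons_cons_empty, Submodule.mem_span_pair] at hw
  obtain ⟨u, v, h⟩ := hw
  exact ⟨u, v, by simpa [Rat.smul_def] using h.symm⟩

/-- The rational squares of `ℚ(√d)` are the rational numbers `c` such that `c` or `c * d` is a
square in `ℚ`. -/
lemma isSquare_or_isSquare_mul_of_isSquare {F : Type*} [Field F] [NumberField F]
    (hdeg : Module.finrank ℚ F = 2) {d : ℕ} (hd : ¬ IsSquare d) {α : F} (hα : α ^ 2 = d) {c : ℚ}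
    (hc : IsSquare (c : F)) : IsSquare c ∨ IsSquare (c * d) := by
  obtain ⟨hind, hspan⟩ := exists_eq_add_mul_sqrt hdeg hd hα
  obtain ⟨w, hw⟩ := hc
  obtain ⟨u, v, rfl⟩ := hspan w
  obtain ⟨h₁, h₂⟩ := hind (u ^ 2 + d * v ^ 2 - c) (2 * u * v) (by
    push_cast
    rw [hw, ← hα]
    ring)
  rcases mul_eq_zero.mp h₂ with h | h
  · obtain rfl : u = 0 := by simpa using h
    exact Or.inr ⟨d * v, by linear_combination -(d : ℚ) * h₁⟩
  · subst h
    exact Or.inl ⟨u, by linear_combination -h₁⟩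

lemma isSquare_nat_of_isSquareUpToSign {F : Type*} [Field F] [NumberField F]
    (hdeg : Module.finrank ℚ F = 2) {d : ℕ} (hd : ¬ IsSquare d) {α : F} (hα : α ^ 2 = d) {n : ℕ}
    (hn : n ≠ 0) (h : IsSquareUpToSign (n : F)) : IsSquare n ∨ IsSquare (n * d) := by
  have hd0 : d ≠ 0 := by rintro rfl; exact hd (IsSquare.zero)
  rcases h with h | h
  · have := isSquare_or_isSquare_mul_of_isSquare hdeg hd hα (c := n) (by simpa using h)
    rw [← Nat.cast_mul] at this
    simpa only [Rat.isSquare_natCast_iff] using this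
  · have hn' : (0 : ℚ) < n := by positivity
    have hd' : (0 : ℚ) < d := by positivity
    rcases isSquare_or_isSquare_mul_of_isSquare hdeg hd hα (c := -n) (by simpa using h) with h | h
    · have := h.nonneg
      linarith
    · have := h.nonneg
      nlinarith [mul_pos hn' hd']

/-- A nonzero rational multiple of `a + √d`, where `d = a² + b²`, is not a square in `ℚ(√d)`. -/
lemma not_isSquare_rat_mul_add_sqrt {F : Type*} [Field F] [NumberField F]
    (hdeg : Module.finrank ℚ F = 2) {d : ℕ} (hd : ¬ IsSquare d) {α : F} (hα : α ^ 2 = d) {a b : ℚ}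
    (hb : b ≠ 0) (hab : (d : ℚ) = a ^ 2 + b ^ 2) {c : ℚ} (hc : c ≠ 0) :
    ¬ IsSquare ((c : F) * (a + α)) := by
  obtain ⟨hind, hspan⟩ := exists_eq_add_mul_sqrt hdeg hd hα
  rintro ⟨w, hw⟩
  obtain ⟨u, v, rfl⟩ := hspan w
  obtain ⟨h₁, h₂⟩ := hind (u ^ 2 + d * v ^ 2 - c * a) (2 * u * v - c) (by
    push_cast
    rw [← hα]
    linear_combination -hw)
  have h₃ : (u - a * v) ^ 2 + (b * v) ^ 2 = 0 := by
    linear_combination h₁ - a * h₂ - v ^ 2 * hab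
  have hv : v = 0 := by
    have : b * v = 0 := by nlinarith [sq_nonneg (u - a * v), sq_nonneg (b * v)]
    simpa [hb] using this
  subst hv
  exact hc (by linear_combination -h₂)

lemma not_isSquareUpToSign_nat_mul_add_sqrt {F : Type*} [Field F] [NumberField F]
    (hdeg : Module.finrank ℚ F = 2) {d : ℕ} (hd : ¬ IsSquare d) {α : F} (hα : α ^ 2 = d) {a b : ℕ}
    (hb : b ≠ 0) (hab : d = a ^ 2 + b ^ 2) {n : ℕ} (hn : n ≠ 0) :
    ¬ IsSquareUpToSign ((n : F) * (a + α)) := by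
  have key (c : ℚ) (hc : c ≠ 0) := not_isSquare_rat_mul_add_sqrt hdeg hd hα (a := a) (b := b)
    (by exact_mod_cast hb) (by exact_mod_cast hab) hc
  rintro (h | h)
  · exact key n (by exact_mod_cast hn) (by simpa using h)
  · exact key (-n) (by simpa using hn) (by simpa using h)

lemma even_factorization_of_isSquare {n : ℕ} (h : IsSquare n) (l : ℕ) :
    Even (n.factorization l) := by
  obtain ⟨m, rfl⟩ := h
  rw [← sq, Nat.factorization_pow]
  simp

lemma factorization_prime_pow_mul_pow_mul_pow {p q r : ℕ} (hp : p.Prime) (hq : q.Prime)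
    (hr : r.Prime) (i j k : ℕ) :
    (p ^ i * q ^ j * r ^ k).factorization =
      Finsupp.single p i + Finsupp.single q j + Finsupp.single r k := by
  have hp0 := pow_ne_zero i hp.ne_zero
  have hq0 := pow_ne_zero j hq.ne_zero
  rw [Nat.factorization_mul (mul_ne_zero hp0 hq0) (pow_ne_zero k hr.ne_zero),
    Nat.factorization_mul hp0 hq0, hp.factorization_pow, hq.factorization_pow,
    hr.factorization_pow]

lemma even_of_isSquare_prime_pow_mul {p q r : ℕ} (hp : p.Prime) (hq : q.Prime) (hr : r.Prime)
    (hpq : p ≠ q) (hpr : p ≠ r) (hqr : q ≠ r) {i j k : ℕ}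
    (h : IsSquare (p ^ i * q ^ j * r ^ k)) : Even i ∧ Even j ∧ Even k := by
  have key := even_factorization_of_isSquare h
  rw [factorization_prime_pow_mul_pow_mul_pow hp hq hr] at key
  refine ⟨by simpa [hpq, hpr, hpq.symm, hpr.symm] using key p,
    by simpa [hpq, hqr, hpq.symm, hqr.symm] using key q,
    by simpa [hpr, hqr, hpr.symm, hqr.symm] using key r⟩

/-- The numbers `p`, `q` and `a + √d`, with `d = p * q * r = a² + b²`, are independent modulo
squares and signs in `ℚ(√d)`. -/
lemma even_of_isSquareUpToSign {F : Type*} [Field F] [NumberField F]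
    (hdeg : Module.finrank ℚ F = 2) {p q r : ℕ} (hp : p.Prime) (hq : q.Prime) (hr : r.Prime)
    (hpq : p ≠ q) (hpr : p ≠ r) (hqr : q ≠ r) {α : F} (hα : α ^ 2 = (p * q * r : ℕ)) {a b : ℕ}
    (hb : b ≠ 0) (hab : p * q * r = a ^ 2 + b ^ 2) {i j k : ℕ}
    (h : IsSquareUpToSign ((p : F) ^ i * (q : F) ^ j * (a + α) ^ k)) :
    Even i ∧ Even j ∧ Even k := by
  have hd : ¬ IsSquare (p * q * r) := fun hsq ↦ by
    have := (even_of_isSquare_prime_pow_mul hp hq hr hpq hpr hqr (i := 1) (j := 1) (k := 1)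
      (by simpa using hsq)).1
    simp at this
  have hn : p ^ i * q ^ j ≠ 0 := mul_ne_zero (pow_ne_zero _ hp.ne_zero) (pow_ne_zero _ hq.ne_zero)
  have hβ : (a : F) + α ≠ 0 := fun h0 ↦
    not_isSquareUpToSign_nat_mul_add_sqrt hdeg hd hα hb hab one_ne_zero
      (Or.inl (by rw [h0, mul_zero]; exact IsSquare.zero))
  rcases Nat.even_or_odd' k with ⟨m, rfl | rfl⟩
  · have h' : IsSquareUpToSign ((p ^ i * q ^ j : ℕ) : F) := by
      refine IsSquareUpToSign.of_sq_mul (pow_ne_zero m hβ) ?_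
      convert h using 1
      push_cast
      ring
    rcases isSquare_nat_of_isSquareUpToSign hdeg hd hα hn h' with h' | h'
    · obtain ⟨hi, hj, -⟩ := even_of_isSquare_prime_pow_mul hp hq hr hpq hpr hqr (k := 0)
        (by simpa using h')
      exact ⟨hi, hj, even_two_mul m⟩
    · have := (even_of_isSquare_prime_pow_mul hp hq hr hpq hpr hqr (i := i + 1) (j := j + 1)
        (k := 1) (by convert h' using 1; ring)).2.2
      simp at this
  · refine absurd ?_ (not_isSquareUpToSign_nat_mul_add_sqrt hdeg hd hα hb hab hn)
    refine IsSquareUpToSign.of_sq_mul (pow_ne_zero m hβ) ?_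
    convert h using 1
    push_cast
    ring

lemma exists_coprime_sq_add_sq {d : ℕ} (hsf : Squarefree d) (hodd : Odd d)
    (hd : IsSquare (-1 : ZMod d)) : ∃ a b : ℕ, d = a ^ 2 + b ^ 2 ∧ (2 * a).Coprime b := by
  have aux (x y : ℕ) (h : d = x ^ 2 + y ^ 2) (hy : Odd y) : (2 * x).Coprime y := by
    refine Nat.Coprime.mul_left (Nat.coprime_two_left.mpr hy) ?_
    refine Nat.isUnit_iff.mp (hsf (x.gcd y) ?_)
    rw [h, ← sq]
    exact dvd_add (pow_dvd_pow_of_dvd (Nat.gcd_dvd_left x y) 2)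
      (pow_dvd_pow_of_dvd (Nat.gcd_dvd_right x y) 2)
  obtain ⟨x, y, h⟩ := Nat.eq_sq_add_sq_of_isSquare_mod_neg_one hd
  rcases Nat.even_or_odd y with hy | hy
  · refine ⟨y, x, by rw [h, add_comm], aux y x (by rw [h, add_comm]) ?_⟩
    rw [h, Nat.odd_add] at hodd
    exact (Nat.odd_pow_iff two_ne_zero).mp (hodd.mpr (hy.pow_of_ne_zero two_ne_zero))
  · exact ⟨x, y, h, aux x y h hy⟩

/-- If `p, q, r` are distinct primes all congruent to `1` mod `4`, then `4` divides
the class number of the real quadratic field `ℚ(√(p q r))`. -/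
theorem four_dvd_classNumber_real (p q r : ℕ) (hp : p.Prime) (hq : q.Prime)
    (hr : r.Prime) (hpq : p ≠ q) (hpr : p ≠ r) (hqr : q ≠ r)
    (hpmod : p % 4 = 1) (hqmod : q % 4 = 1) (hrmod : r % 4 = 1)
    (F : Type) [Field F] [NumberField F] (hdeg : Module.finrank ℚ F = 2)
    (hgen : ∃ α : F, α ^ 2 = (p : F) * q * r) :
    4 ∣ NumberField.classNumber F := by
  obtain ⟨α, hα⟩ := hgen
  have cpq := (Nat.coprime_primes hp hq).mpr hpq
  have cpr := (Nat.coprime_primes hp hr).mpr hpr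
  have cqr := (Nat.coprime_primes hq hr).mpr hqr
  have cpqr : (p * q).Coprime r := Nat.Coprime.mul_left cpr cqr
  have hodd : Odd (p * q * r) := by
    refine Odd.mul (Odd.mul ?_ ?_) ?_ <;> rw [Nat.odd_iff] <;> omega
  have hsf : Squarefree (p * q * r) :=
    (Nat.squarefree_mul cpqr).mpr ⟨(Nat.squarefree_mul cpq).mpr
      ⟨hp.prime.squarefree, hq.prime.squarefree⟩, hr.prime.squarefree⟩
  have hneg : IsSquare (-1 : ZMod (p * q * r)) := by
    have : Fact p.Prime := ⟨hp⟩
    have : Fact q.Prime := ⟨hq⟩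
    have : Fact r.Prime := ⟨hr⟩
    refine ZMod.isSquare_neg_one_mul cpqr (ZMod.isSquare_neg_one_mul cpq ?_ ?_) ?_ <;>
      rw [ZMod.exists_sq_eq_neg_one_iff] <;> omega
  obtain ⟨a, b, hab, hcop⟩ := exists_coprime_sq_add_sq hsf hodd hneg
  have hd : ¬ IsSquare (p * q * r) := fun hsq ↦ by
    have := (even_of_isSquare_prime_pow_mul hp hq hr hpq hpr hqr (i := 1) (j := 1) (k := 1)
      (by simpa using hsq)).1
    simp at this
  have hb : b ≠ 0 := by
    rintro rfl
    simp at hcop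
  replace hα : α ^ 2 = (p * q * r : ℕ) := by rw [hα]; push_cast; rfl
  have hint : IsIntegral ℤ α := by
    refine IsIntegral.of_pow two_pos ?_
    rw [hα]
    exact_mod_cast isIntegral_algebraMap (R := ℤ) (A := F) (x := ((p * q * r : ℕ) : ℤ))
  obtain ⟨A, rfl⟩ : ∃ A : 𝓞 F, (A : F) = α := ⟨⟨α, hint⟩, rfl⟩
  have hA : A ^ 2 = (p : 𝓞 F) * q * r := by
    apply RingOfIntegers.ext
    simpa using hα
  have hab' : (p : 𝓞 F) * q * r = a ^ 2 + b ^ 2 := by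
    exact_mod_cast congrArg (Nat.cast (R := 𝓞 F)) hab
  have hP : Ideal.span {(p : 𝓞 F), A} ^ 2 = Ideal.span {(p : 𝓞 F)} :=
    span_pair_sq_of_isCoprime (z := ((q * r : ℕ) : 𝓞 F)) (cpq.mul_right cpr).cast
      (by rw [hA]; push_cast; ring)
  have hQ : Ideal.span {(q : 𝓞 F), A} ^ 2 = Ideal.span {(q : 𝓞 F)} :=
    span_pair_sq_of_isCoprime (z := ((p * r : ℕ) : 𝓞 F)) (cpq.symm.mul_right cqr).cast
      (by rw [hA]; push_cast; ring)
  have hB : Ideal.span {(a : 𝓞 F) + A, (b : 𝓞 F)} ^ 2 = Ideal.span {(a : 𝓞 F) + A} := by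
    refine span_pair_sq_of_isCoprime (z := A - a) ?_ (by linear_combination -hA - hab')
    obtain ⟨s, t, hst⟩ : IsCoprime ((2 * a : ℕ) : 𝓞 F) ((b ^ 2 : ℕ) : 𝓞 F) :=
      (hcop.pow_right 2).cast
    push_cast at hst
    exact ⟨s + t * (A - a), -s, by linear_combination hst + t * (hA + hab')⟩
  have hneg1 : ¬ IsSquare (-1 : F) := fun h ↦ by
    rcases isSquare_or_isSquare_mul_of_isSquare hdeg hd hα (c := -1) (by simpa using h) with h | h
    · have := h.nonneg
      norm_num at this
    · have := h.nonneg
      have : (0 : ℚ) < (p * q * r : ℕ) := by exact_mod_cast hodd.pos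
      linarith
  have hind {i j k : ℕ} := even_of_isSquareUpToSign hdeg hp hq hr hpq hpr hqr hα hb hab
    (i := i) (j := j) (k := k)
  have hβ : (a : 𝓞 F) + A ≠ 0 := fun h ↦ by
    have := (hind (i := 0) (j := 0) (k := 1) (Or.inl (by
      have h' := congrArg (algebraMap (𝓞 F) F) h
      simp only [map_add, map_natCast, map_zero] at h'
      simp [h']))).2.2
    simp at this
  refine four_dvd_classNumber_of_independent hneg1 (rank_le_one_of_finrank_eq_two hdeg)
    (ι := Fin 2 × Fin 2 × Fin 2) (by simp)
    (fun e ↦ (p : 𝓞 F) ^ (e.1 : ℕ) * (q : 𝓞 F) ^ (e.2.1 : ℕ) * (a + A) ^ (e.2.2 : ℕ))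
    (fun e ↦ Ideal.span {(p : 𝓞 F), A} ^ (e.1 : ℕ) * Ideal.span {(q : 𝓞 F), A} ^ (e.2.1 : ℕ) *
      Ideal.span {(a : 𝓞 F) + A, (b : 𝓞 F)} ^ (e.2.2 : ℕ)) ?_ ?_ ?_
  · intro e
    have hp0 : (p : 𝓞 F) ≠ 0 := by exact_mod_cast hp.ne_zero
    have hq0 : (q : 𝓞 F) ≠ 0 := by exact_mod_cast hq.ne_zero
    positivity
  · intro e
    simp only [mul_pow, pow_right_comm _ _ 2, hP, hQ, hB, Ideal.span_singleton_pow,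
      Ideal.span_singleton_mul_span_singleton]
  · rintro ⟨i, j, k⟩ ⟨i', j', k'⟩ h
    obtain ⟨hi, hj, hk⟩ := hind (i := i + i') (j := j + j') (k := k + k') (by
      convert h using 1
      push_cast
      ring)
    have aux (x y : Fin 2) (h : Even ((x : ℕ) + y)) : x = y := by
      rw [Nat.even_iff] at h
      omega
    rw [aux i i' hi, aux j j' hj, aux k k' hk]
end

section
/- The imaginary bicyclic biquadratic field K = ℚ(√(-5), √(-23)) has class number 6, and its three quadratic subfields ℚ(√(-5)), ℚ(√(-23)), ℚ(√115) have class numbers 2, 3, 2 respectively. -/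
open Module NumberField Matrix
open scoped nonZeroDivisors Real

section QuadraticExtension
variable {F L : Type*} [Field F] [Field L] [Algebra F L]

theorem exists_basis_of_sq_eq (h : finrank F L = 2) {γ : L} {c : F}
    (hγ : γ ^ 2 = algebraMap F L c) (hc : ¬ IsSquare c) :
    ∃ b : Basis (Fin 2) F L, b 0 = 1 ∧ b 1 = γ := by
  have hli : LinearIndependent F ![(1 : L), γ] := by
    rw [LinearIndependent.pair_iff]
    intro s t hst
    rcases eq_or_ne t 0 with rfl | ht
    · simpa using hst
    · refine absurd ⟨-s / t, (algebraMap F L).injective ?_⟩ hc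
      have ht' : algebraMap F L t ≠ 0 := by simpa using ht
      have hg : γ = algebraMap F L (-s / t) := by
        simp only [Algebra.smul_def] at hst
        rw [map_div₀, map_neg, eq_div_iff ht']
        linear_combination hst
      rw [← hγ, hg, map_mul, sq]
  refine ⟨basisOfLinearIndependentOfCardEqFinrank hli (by simp [h]), ?_, ?_⟩ <;> simp

theorem exists_eq_add_mul_of_sq_eq (h : finrank F L = 2) {γ : L} {c : F}
    (hγ : γ ^ 2 = algebraMap F L c) (hc : ¬ IsSquare c) (z : L) :
    ∃ x y : F, z = algebraMap F L x + algebraMap F L y * γ := by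
  obtain ⟨b, h0, h1⟩ := exists_basis_of_sq_eq h hγ hc
  refine ⟨b.repr z 0, b.repr z 1, ?_⟩
  conv_lhs => rw [← b.sum_repr z]
  simp [Fin.sum_univ_two, h0, h1, Algebra.smul_def]

theorem leftMulMatrix_of_sq_eq {γ : L} {c : F} (hγ : γ ^ 2 = algebraMap F L c)
    (b : Basis (Fin 2) F L) (h0 : b 0 = 1) (h1 : b 1 = γ) (x y : F) :
    Algebra.leftMulMatrix b (algebraMap F L x + algebraMap F L y * γ) =
      !![x, c * y; y, x] := by
  have e : ∀ u v : F, b.repr (algebraMap F L u + algebraMap F L v * γ) =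
      Finsupp.single 0 u + Finsupp.single 1 v := by
    intro u v
    rw [← h1, ← mul_one (algebraMap F L u), ← h0, ← Algebra.smul_def, ← Algebra.smul_def]
    simp
  ext i j
  rw [Algebra.leftMulMatrix_eq_repr_mul]
  fin_cases j
  · simp only [Fin.zero_eta, h0, mul_one, e]
    fin_cases i <;> simp
  · have : (algebraMap F L x + algebraMap F L y * γ) * γ =
        algebraMap F L (c * y) + algebraMap F L x * γ := by
      rw [map_mul]; linear_combination algebraMap F L y * hγ
    simp only [Fin.mk_one, h1, this, e]
    fin_cases i <;> simp

theorem norm_of_sq_eq (h : finrank F L = 2) {γ : L} {c : F}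
    (hγ : γ ^ 2 = algebraMap F L c) (hc : ¬ IsSquare c) (x y : F) :
    Algebra.norm F (algebraMap F L x + algebraMap F L y * γ) = x ^ 2 - c * y ^ 2 := by
  obtain ⟨b, h0, h1⟩ := exists_basis_of_sq_eq h hγ hc
  rw [Algebra.norm_eq_matrix_det b, leftMulMatrix_of_sq_eq hγ b h0 h1]
  simp [Matrix.det_fin_two]; ring

theorem trace_of_sq_eq (h : finrank F L = 2) {γ : L} {c : F}
    (hγ : γ ^ 2 = algebraMap F L c) (hc : ¬ IsSquare c) (x y : F) :
    Algebra.trace F L (algebraMap F L x + algebraMap F L y * γ) = 2 * x := by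
  obtain ⟨b, h0, h1⟩ := exists_basis_of_sq_eq h hγ hc
  rw [Algebra.trace_eq_matrix_trace b, leftMulMatrix_of_sq_eq hγ b h0 h1]
  simp [Matrix.trace_fin_two]; ring

/-- In a quadratic extension `F(√c)` of characteristic not two, an element `e` of `F` is a square
only if `e` or `e / c` is a square in `F`. -/
theorem isSquare_or_of_isSquare_algebraMap (h2 : (2 : F) ≠ 0) (h : finrank F L = 2) {γ : L} {c : F}
    (hγ : γ ^ 2 = algebraMap F L c) (hc : ¬ IsSquare c) {e : F}
    (he : IsSquare (algebraMap F L e)) : IsSquare e ∨ IsSquare (e * c) := by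
  obtain ⟨r, hr⟩ := he
  obtain ⟨x, y, rfl⟩ := exists_eq_add_mul_of_sq_eq h hγ hc r
  have key : algebraMap F L (x ^ 2 + c * y ^ 2 - e) + algebraMap F L (2 * x * y) * γ =
      algebraMap F L 0 + algebraMap F L 0 * γ := by
    push_cast [map_mul, map_sub, map_add, map_pow, map_zero, map_ofNat]
    linear_combination -hr - algebraMap F L y ^ 2 * hγ
  have inj : x ^ 2 + c * y ^ 2 - e = 0 ∧ 2 * x * y = 0 := by
    obtain ⟨b, h0, h1⟩ := exists_basis_of_sq_eq h hγ hc
    have := congrArg (Algebra.leftMulMatrix b) key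
    rw [leftMulMatrix_of_sq_eq hγ b h0 h1, leftMulMatrix_of_sq_eq hγ b h0 h1] at this
    exact ⟨by simpa using congrFun (congrFun this 0) 0, by simpa using congrFun (congrFun this 1) 0⟩
  obtain ⟨i1, i2⟩ := inj
  rcases mul_eq_zero.mp i2 with h' | rfl
  · obtain rfl := (mul_eq_zero.mp h').resolve_left h2
    exact .inr ⟨c * y, by linear_combination -c * i1⟩
  · exact .inl ⟨x, by linear_combination -i1⟩

end QuadraticExtension

/-- The discriminant of any family of `[F : ℚ]` integers bounds the discriminant. -/
theorem abs_discr_le_of_traceMatrix {F : Type*} [Field F] [NumberField F] {n : ℕ}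
    (hn : finrank ℚ F = n) (v : Fin n → 𝓞 F) {D : ℤ} (hD : D ≠ 0)
    (h : (Algebra.traceMatrix ℚ (fun i => (v i : F))).det = D) : |discr F| ≤ |D| := by
  let e : Module.Free.ChooseBasisIndex ℤ (𝓞 F) ≃ Fin n := Fintype.equivFinOfCardEq
    (by rw [← Module.finrank_eq_card_chooseBasisIndex, RingOfIntegers.rank, hn])
  let b := (RingOfIntegers.basis F).reindex e
  have hZ : Algebra.discr ℤ v = D := by
    have : (Algebra.discr ℤ v : ℚ) = D := by
      rw [← h, Algebra.discr_def, ← eq_intCast (algebraMap ℤ ℚ), RingHom.map_det]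
      congr 1
      ext i j
      simpa [Algebra.traceMatrix_apply, Algebra.traceForm_apply] using
        Algebra.coe_trace_int (K := F) (v i * v j)
    exact_mod_cast this
  have hv : v = b ᵥ* (b.toMatrix v).map (algebraMap ℤ (𝓞 F)) := by
    ext1 i
    conv_lhs => rw [← b.sum_repr (v i)]
    simp [Matrix.vecMul, dotProduct, Basis.toMatrix_apply, mul_comm]
  rw [hv, Algebra.discr_of_matrix_vecMul, discr_eq_discr] at hZ
  have hP : (b.toMatrix v).det ^ 2 ≠ 0 := fun h0 => hD (by rw [← hZ, h0, zero_mul])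
  rw [← hZ, abs_mul]
  exact le_mul_of_one_le_left (abs_nonneg _) (Int.one_le_abs hP)

section ClassGroup

variable {R : Type*} [CommRing R] [IsDedekindDomain R]

/-- The class of the ideal `I` belongs to `H`; this holds vacuously if `I = 0`. -/
def Ideal.ClassMem (H : Subgroup (ClassGroup R)) (I : Ideal R) : Prop :=
  ∀ hI : I ∈ (Ideal R)⁰, ClassGroup.mk0 ⟨I, hI⟩ ∈ H

variable {H : Subgroup (ClassGroup R)}

theorem Ideal.ClassMem.mul {I J : Ideal R} (hI : I.ClassMem H) (hJ : J.ClassMem H) :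
    (I * J).ClassMem H := by
  intro h
  have hI0 : I ∈ (Ideal R)⁰ := mem_nonZeroDivisors_iff_ne_zero.mpr <| by
    rintro rfl; exact (mem_nonZeroDivisors_iff_ne_zero.mp h) (by simp)
  have hJ0 : J ∈ (Ideal R)⁰ := mem_nonZeroDivisors_iff_ne_zero.mpr <| by
    rintro rfl; exact (mem_nonZeroDivisors_iff_ne_zero.mp h) (by simp)
  have : (⟨I * J, h⟩ : (Ideal R)⁰) = ⟨I, hI0⟩ * ⟨J, hJ0⟩ := rfl
  rw [this, map_mul]
  exact H.mul_mem (hI hI0) (hJ hJ0)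

theorem Ideal.ClassMem.of_mul_eq_span {I J : Ideal R} {x : R} (hx : x ≠ 0)
    (h : I * J = span {x}) (hJ : J.ClassMem H) : I.ClassMem H := by
  intro hI0
  have hJ0 : J ∈ (Ideal R)⁰ := mem_nonZeroDivisors_iff_ne_zero.mpr <| by
    rintro rfl
    rw [mul_zero, eq_comm, Ideal.zero_eq_bot, span_singleton_eq_bot] at h
    exact hx h
  have : ClassGroup.mk0 ⟨I, hI0⟩ = (ClassGroup.mk0 ⟨J, hJ0⟩)⁻¹ :=
    ClassGroup.mk0_eq_mk0_inv_iff.mpr ⟨x, hx, h⟩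
  rw [this]
  exact H.inv_mem (hJ hJ0)

theorem Ideal.classMem_top : (⊤ : Ideal R).ClassMem H := fun hI => by
  rw [(ClassGroup.mk0_eq_one_iff hI).mpr (inferInstance)]
  exact H.one_mem

theorem Ideal.classMem_of_forall_isPrime {I : Ideal R} (hI : I ≠ ⊥)
    (h : ∀ P : Ideal R, P.IsPrime → P ≠ ⊥ → I ≤ P → P.ClassMem H) : I.ClassMem H := by
  induction I using UniqueFactorizationMonoid.induction_on_prime with
  | h₁ => exact absurd rfl hI
  | h₂ x hx => rw [Ideal.isUnit_iff.mp hx]; exact Ideal.classMem_top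
  | h₃ a p ha hp ih =>
    exact (h p (Ideal.isPrime_of_prime hp) hp.ne_zero Ideal.mul_le_left).mul
      (ih ha fun P hP hP0 haP => h P hP hP0 (Ideal.mul_le_right.trans haP))

end ClassGroup

section NumberField

variable {F : Type*} [Field F] [NumberField F]

/-- An upper bound for the Minkowski constant that only depends on the degree and on an upper bound
for the discriminant. -/
theorem exists_absNorm_le_of_abs_discr_le {n : ℕ} (hn : finrank ℚ F = 2 * n) {D : ℤ}
    (hD : |discr F| ≤ D) (C : ClassGroup (𝓞 F)) :
    ∃ I : (Ideal (𝓞 F))⁰, ClassGroup.mk0 I = C ∧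
      (Ideal.absNorm (I : Ideal (𝓞 F)) : ℝ) ≤
        (4 / π) ^ n * (((2 * n).factorial : ℝ) / ((2 * n : ℕ) : ℝ) ^ (2 * n) * √D) := by
  obtain ⟨I, hI, hle⟩ := exists_ideal_in_class_of_norm_le C
  refine ⟨I, hI, hle.trans ?_⟩
  rw [hn]
  have hr : InfinitePlace.nrComplexPlaces F ≤ n := by
    have := InfinitePlace.card_add_two_mul_card_eq_rank F
    omega
  have h1 : (1 : ℝ) ≤ 4 / π := by
    rw [le_div_iff₀ Real.pi_pos]; linarith [Real.pi_le_four]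
  have hD' : ((|discr F| : ℤ) : ℝ) ≤ D := by exact_mod_cast hD
  rw [Int.cast_abs] at hD'
  gcongr

/-- To show that a subgroup is the whole class group, it is enough to consider the prime ideals of
norm at most the Minkowski bound. -/
theorem eq_top_of_forall_isPrime {n B : ℕ} (hn : finrank ℚ F = 2 * n) {D : ℤ}
    (hD : |discr F| ≤ D)
    (hB : (4 / π) ^ n * (((2 * n).factorial : ℝ) / ((2 * n : ℕ) : ℝ) ^ (2 * n) * √D) < B + 1)
    {H : Subgroup (ClassGroup (𝓞 F))}
    (h : ∀ P : Ideal (𝓞 F), P.IsPrime → P ≠ ⊥ → Ideal.absNorm P ≤ B → P.ClassMem H) :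
    H = ⊤ := by
  refine eq_top_iff.mpr fun C _ => ?_
  obtain ⟨I, rfl, hI⟩ := exists_absNorm_le_of_abs_discr_le hn hD C
  have hIB : Ideal.absNorm (I : Ideal (𝓞 F)) ≤ B :=
    Nat.lt_succ_iff.mp (by exact_mod_cast hI.trans_lt hB)
  refine Ideal.classMem_of_forall_isPrime (nonZeroDivisors.coe_ne_zero I)
    (fun P hP hP0 hle => h P hP hP0 (le_trans ?_ hIB)) I.2
  exact Nat.le_of_dvd (Ideal.absNorm_pos_of_nonZeroDivisors I) (Ideal.absNorm_dvd_absNorm_of_le hle)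

theorem absNorm_span_singleton_eq (x : 𝓞 F) {m : ℤ} (h : Algebra.norm ℚ (x : F) = m) :
    Ideal.absNorm (Ideal.span {x}) = m.natAbs := by
  rw [Ideal.absNorm_span_singleton]
  congr 1
  exact_mod_cast (Algebra.coe_norm_int x).trans h

/-- A nonzero prime ideal has norm a prime power. -/
theorem exists_absNorm_eq_pow_of_isPrime (P : Ideal (𝓞 F)) [P.IsPrime] (h : P ≠ ⊥) :
    ∃ p f : ℕ, p.Prime ∧ 0 < f ∧ (p : 𝓞 F) ∈ P ∧ Ideal.absNorm P = p ^ f := by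
  have : P.IsMaximal := Ideal.IsPrime.isMaximal inferInstance h
  let _ := Ideal.Quotient.field P
  have : Finite (𝓞 F ⧸ P) := Ideal.finiteQuotientOfFreeOfNeBot P h
  have : Fintype (𝓞 F ⧸ P) := Fintype.ofFinite _
  obtain ⟨p, hp⟩ := CharP.exists (𝓞 F ⧸ P)
  obtain ⟨f, hp', hf⟩ := FiniteField.card (𝓞 F ⧸ P) p
  refine ⟨p, f, hp', f.pos, ?_, ?_⟩
  · rw [← Ideal.Quotient.eq_zero_iff_mem, map_natCast, CharP.cast_eq_zero]
  · rw [← hf, ← Nat.card_eq_fintype_card, Ideal.absNorm_apply]; rfl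

/-- A prime ideal of prime norm `p` is the kernel of a reduction map to `ZMod p`. -/
theorem exists_ringHom_of_absNorm_eq {P : Ideal (𝓞 F)} {p : ℕ} (hp : p.Prime)
    (h : Ideal.absNorm P = p) : Nonempty (𝓞 F →+* ZMod p) := by
  have : Fact p.Prime := ⟨hp⟩
  have hc : Nat.card (𝓞 F ⧸ P) = p := by rw [← h, Ideal.absNorm_apply]; rfl
  have : Finite (𝓞 F ⧸ P) := Nat.finite_of_card_ne_zero (hc ▸ hp.ne_zero)
  have : Fintype (𝓞 F ⧸ P) := Fintype.ofFinite _
  exact ⟨(ZMod.ringEquivOfPrime _ hp (by rw [← Nat.card_eq_fintype_card, hc])).symm.toRingHom.comp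
    (Ideal.Quotient.mk P)⟩

/-- Let `P` be a prime ideal of norm `q` that contains an element `x` of norm `± q m`. If the
classes of all the prime ideals that contain `m` belong to `H`, so does the class of `P`. -/
theorem Ideal.classMem_of_mem {H : Subgroup (ClassGroup (𝓞 F))} {P : Ideal (𝓞 F)} {q m : ℕ}
    (hq : q ≠ 0) (hP : absNorm P = q) {x : 𝓞 F} (hx : x ∈ P) (hm : m ≠ 0)
    (hxn : absNorm (span {x}) = q * m)
    (h : ∀ Q : Ideal (𝓞 F), Q.IsPrime → Q ≠ ⊥ → (m : 𝓞 F) ∈ Q → Q.ClassMem H) :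
    P.ClassMem H := by
  obtain ⟨J, hJ⟩ := Ideal.dvd_iff_le.mpr ((span_singleton_le_iff_mem P).mpr hx)
  have hx0 : x ≠ 0 := by
    rintro rfl
    simp at hxn; omega
  have hJm : absNorm J = m := by
    rw [hJ, map_mul, hP] at hxn
    exact Nat.eq_of_mul_eq_mul_left (Nat.pos_of_ne_zero hq) hxn
  refine ClassMem.of_mul_eq_span hx0 hJ.symm (classMem_of_forall_isPrime ?_ ?_)
  · rintro rfl; simp at hJm; omega
  · intro Q hQ hQ0 hle
    exact h Q hQ hQ0 (hle (hJm ▸ absNorm_mem J))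

end NumberField

section IdealIdentities

variable {R : Type*} [CommRing R]

theorem Ideal.span_two_one_add_sq {γ k : R} (h : γ ^ 2 = 4 * k - 1) :
    Ideal.span {2, 1 + γ} ^ 2 = Ideal.span {2} := by
  rw [sq, span_pair_mul_span_pair]
  apply le_antisymm
  · rw [span_le]
    rintro x (rfl | rfl | rfl | rfl) <;> rw [SetLike.mem_coe, mem_span_singleton]
    · exact ⟨2, by ring⟩
    · exact ⟨1 + γ, by ring⟩
    · exact ⟨1 + γ, by ring⟩
    · exact ⟨2 * k + γ, by linear_combination h⟩
  · rw [span_singleton_le_iff_mem]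
    have e : k * (2 * 2) + 2 * (1 + γ) - (1 + γ) * (1 + γ) = (2 : R) := by linear_combination -h
    refine (congrArg (· ∈ span _) e).mp (sub_mem (add_mem (Ideal.mul_mem_left _ _ ?_) ?_) ?_) <;>
      apply subset_span <;> simp

theorem Ideal.span_two_pow_three {ω : R} (h : ω ^ 2 = ω - 6) :
    Ideal.span {2, ω} ^ 3 = Ideal.span {2 - ω} := by
  have h2 : Ideal.span {2, ω} ^ 2 = Ideal.span {4, 2 - ω} := by
    rw [sq, span_pair_mul_span_pair]
    apply le_antisymm
    · rw [span_le]
      rintro x (rfl | rfl | rfl | rfl) <;> rw [SetLike.mem_coe, mem_span_pair]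
      · exact ⟨1, 0, by ring⟩
      · exact ⟨1, -2, by ring⟩
      · exact ⟨1, -2, by ring⟩
      · exact ⟨-1, -1, by linear_combination -h⟩
    · rw [span_le]
      rintro x (rfl | rfl)
      · apply subset_span; left; norm_num
      · have e : 2 - ω = (-1 : R) * (2 * 2) - ω * ω := by linear_combination h
        rw [SetLike.mem_coe, e]
        refine sub_mem (Ideal.mul_mem_left _ _ ?_) ?_ <;> apply subset_span <;> simp
  rw [pow_succ, h2, span_pair_mul_span_pair]
  apply le_antisymm
  · rw [span_le]
    rintro x (rfl | rfl | rfl | rfl) <;> rw [SetLike.mem_coe, mem_span_singleton]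
    · exact ⟨1 + ω, by linear_combination h⟩
    · exact ⟨ω - 3, by linear_combination h⟩
    · exact ⟨2, by ring⟩
    · exact ⟨ω, by ring⟩
  · rw [span_singleton_le_iff_mem]
    have e : 4 * 2 - (2 - ω) * ω = 2 - ω := by
      linear_combination h
    refine (congrArg (· ∈ span _) e).mp (sub_mem ?_ ?_) <;> apply subset_span <;> simp

theorem Ideal.span_two_mul_span_two {ω : R} (h : ω ^ 2 = ω - 6) :
    Ideal.span {2, ω - 1} * Ideal.span {2, ω} = Ideal.span {2} := by
  rw [span_pair_mul_span_pair]
  apply le_antisymm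
  · rw [span_le]
    rintro x (rfl | rfl | rfl | rfl) <;> rw [SetLike.mem_coe, mem_span_singleton]
    · exact ⟨2, by ring⟩
    · exact ⟨ω, by ring⟩
    · exact ⟨ω - 1, by ring⟩
    · exact ⟨-3, by linear_combination h⟩
  · rw [span_singleton_le_iff_mem]
    have e : 2 * ω - (ω - 1) * 2 = (2 : R) := by ring
    refine (congrArg (· ∈ span _) e).mp (sub_mem ?_ ?_) <;> apply subset_span <;> simp

theorem Ideal.span_triple_sq {θ ω : R} (hθ : θ ^ 2 = -5) (hω : ω ^ 2 = ω - 6) :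
    Ideal.span {2, 1 + θ, ω} ^ 2 = Ideal.span {2, ω} := by
  have m2 : (2 : R) ∈ Ideal.span {2, 1 + θ, ω} := subset_span (by simp)
  have mθ : 1 + θ ∈ Ideal.span {2, 1 + θ, ω} := subset_span (by simp)
  have mω : ω ∈ Ideal.span {2, 1 + θ, ω} := subset_span (by simp)
  have h2 : (2 : R) ∈ Ideal.span {2, 1 + θ, ω} ^ 2 := by
    have e : (2 : R) = 2 * (1 + θ) - (1 + θ) * (1 + θ) - 2 * 2 := by linear_combination hθ
    have := sub_mem (sub_mem (mul_mem_mul m2 mθ) (mul_mem_mul mθ mθ)) (mul_mem_mul m2 m2)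
    rwa [← e, ← sq] at this
  apply le_antisymm
  · rw [sq, Ideal.mul_le]
    have key : ∀ r ∈ Ideal.span {2, 1 + θ, ω}, ∃ a b c : R, r = a * 2 + b * (1 + θ) + c * ω := by
      intro r hr
      obtain ⟨a, s, hs, rfl⟩ := mem_span_insert.mp hr
      obtain ⟨b, c, rfl⟩ := mem_span_pair.mp hs
      exact ⟨a, b, c, by ring⟩
    intro r hr s hs
    obtain ⟨a, b, c, rfl⟩ := key r hr
    obtain ⟨a', b', c', rfl⟩ := key s hs
    rw [mem_span_pair]
    exact ⟨a * (a' * 2 + b' * (1 + θ) + c' * ω) + b * (1 + θ) * a' + b * b' * (θ - 2),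
      b * (1 + θ) * c' + c * (a' * 2 + b' * (1 + θ) + c' * ω), by linear_combination -b * b' * hθ⟩
  · rw [span_le]
    rintro x (rfl | rfl)
    · exact h2
    · have e : x = x * x + 3 * 2 := by linear_combination -hω
      have := add_mem (sq (Ideal.span {2, 1 + θ, x}) ▸ mul_mem_mul mω mω)
        (Ideal.mul_mem_left _ 3 h2)
      rwa [← e] at this

/-- If `θ² = -5` and `ω² = ω - 6` then the two primes above `2` in `ℤ[θ, ω]` are inverse to each
other in the class group. -/
theorem Ideal.span_triple_mul_span_triple {θ ω : R} (hθ : θ ^ 2 = -5) (hω : ω ^ 2 = ω - 6) :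
    Ideal.span {2, 1 + θ, ω - 1} * Ideal.span {2, 1 + θ, ω} =
      Ideal.span {15 * θ - 14 * ω + 7} := by
  set δ := 15 * θ - 14 * ω + 7 with hδ
  have D2 : δ ∣ 2 := ⟨15 * θ + 14 * ω - 7, by
    rw [hδ]; linear_combination -225 * hθ + 196 * hω⟩
  have Dθ : δ ∣ 1 + θ := ⟨-41 + 4 * θ + 7 * ω + 7 * θ * ω, by
    rw [hδ]; linear_combination -(60 + 105 * ω) * hθ + 98 * (1 + θ) * hω⟩
  apply le_antisymm
  · rw [span_mul_span', span_le]
    rintro x ⟨u, hu, v, hv, rfl⟩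
    simp only [Set.mem_insert_iff, Set.mem_singleton_iff] at hu hv
    simp only [SetLike.mem_coe, mem_span_singleton]
    rcases hu with rfl | rfl | hu
    · exact D2.mul_right _
    · exact Dθ.mul_right _
    rcases hv with rfl | rfl | hv
    · exact D2.mul_left _
    · exact Dθ.mul_left _
    · have e : u * v = 2 * (-3) := by rw [hu, hv]; linear_combination hω
      exact e ▸ D2.mul_right _
  · rw [span_singleton_le_iff_mem]
    have m2 : (2 : R) ∈ Ideal.span {2, 1 + θ, ω} := subset_span (by simp)
    have mθ : 1 + θ ∈ Ideal.span {2, 1 + θ, ω} := subset_span (by simp)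
    have mω : ω ∈ Ideal.span {2, 1 + θ, ω} := subset_span (by simp)
    have m2' : (2 : R) ∈ Ideal.span {2, 1 + θ, ω - 1} := subset_span (by simp)
    have mθ' : 1 + θ ∈ Ideal.span {2, 1 + θ, ω - 1} := subset_span (by simp)
    have mω' : ω - 1 ∈ Ideal.span {2, 1 + θ, ω - 1} := subset_span (by simp)
    have e : δ = 15 * ((1 + θ) * ω - (ω - 1) * (1 + θ)) - (4 + 7 * ω) * (2 * ω - (ω - 1) * 2) := by
      rw [hδ]; ring
    rw [e]
    exact sub_mem (Ideal.mul_mem_left _ _ (sub_mem (mul_mem_mul mθ' mω) (mul_mem_mul mω' mθ)))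
      (Ideal.mul_mem_left _ _ (sub_mem (mul_mem_mul m2' mω) (mul_mem_mul mω' m2)))

end IdealIdentities

section ClassNumber

theorem ClassGroup.mk0_pow_eq_one_iff {R : Type*} [CommRing R] [IsDedekindDomain R]
    (I : (Ideal R)⁰) (n : ℕ) : mk0 I ^ n = 1 ↔ ((I : Ideal R) ^ n).IsPrincipal := by
  rw [← map_pow]
  exact mk0_eq_one_iff (I ^ n).2

theorem Ideal.IsPrime.eq_of_irreducible_absNorm {R : Type*} [CommRing R] [IsDedekindDomain R]
    [Module.Free ℤ R] {I P : Ideal R} (hP : P.IsPrime) (hI : Irreducible (absNorm I)) (h : I ≤ P) :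
    I = P := by
  have hp := isPrime_of_irreducible_absNorm hI
  refine (hp.isMaximal ?_).eq_of_le hP.ne_top h
  rintro rfl
  exact hI.ne_zero absNorm_bot

variable {F : Type*} [Field F] [NumberField F]

theorem classNumber_eq_orderOf {C : ClassGroup (𝓞 F)} (h : Subgroup.zpowers C = ⊤) :
    classNumber F = orderOf C := by
  rw [orderOf_eq_card_of_zpowers_eq_top h, classNumber, Nat.card_eq_fintype_card]

theorem absNorm_span_natCast (n : ℕ) :
    Ideal.absNorm (Ideal.span {(n : 𝓞 F)}) = n ^ finrank ℚ F := by
  have := Ideal.absNorm_span_natCast (S := 𝓞 F) n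
  rwa [RingOfIntegers.rank] at this

theorem exists_absNorm_eq_pow_of_natCast_mem {P : Ideal (𝓞 F)} [P.IsPrime] (h0 : P ≠ ⊥) {p : ℕ}
    (hp : p.Prime) (h : (p : 𝓞 F) ∈ P) : ∃ f, 0 < f ∧ Ideal.absNorm P = p ^ f := by
  obtain ⟨q, f, hq, hf, hqP, hPq⟩ := exists_absNorm_eq_pow_of_isPrime P h0
  obtain rfl : p = q := by
    by_contra hne
    have hc : IsCoprime (p : ℤ) q := Nat.isCoprime_iff_coprime.mpr
      ((Nat.coprime_primes hp hq).mpr hne)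
    obtain ⟨a, b, hab⟩ := hc
    refine Ideal.IsPrime.ne_top ‹_› ((Ideal.eq_top_iff_one P).mpr ?_)
    have := congrArg (Int.cast : ℤ → 𝓞 F) hab
    push_cast at this
    rw [← this]
    exact add_mem (P.mul_mem_left _ h) (P.mul_mem_left _ hqP)
  exact ⟨f, hf, hPq⟩

/-- Variant of `Ideal.classMem_of_mem` where `P` is only known to lie above a prime `p` that does
not divide `m`. -/
theorem Ideal.classMem_of_natCast_mem {H : Subgroup (ClassGroup (𝓞 F))} {P : Ideal (𝓞 F)}
    (hP : P.IsPrime) (h0 : P ≠ ⊥) {p m : ℕ} (hp : p.Prime) (hpP : (p : 𝓞 F) ∈ P) {x : 𝓞 F}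
    (hx : x ∈ P) (hm : ¬ p ∣ m) (hxn : absNorm (span {x}) = p * m)
    (h : ∀ Q : Ideal (𝓞 F), Q.IsPrime → Q ≠ ⊥ → (m : 𝓞 F) ∈ Q → Q.ClassMem H) :
    P.ClassMem H := by
  obtain ⟨f, hf, hPf⟩ := exists_absNorm_eq_pow_of_natCast_mem h0 hp hpP
  have hd : p ^ f ∣ p * m := by
    rw [← hPf, ← hxn]
    exact absNorm_dvd_absNorm_of_le ((span_singleton_le_iff_mem P).mpr hx)
  obtain rfl : f = 1 := by
    by_contra h1
    refine hm (Nat.dvd_of_mul_dvd_mul_left hp.pos ((dvd_trans ?_ hd)))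
    rw [← sq]
    exact pow_dvd_pow p (by omega)
  rw [pow_one] at hPf
  exact classMem_of_mem hp.ne_zero hPf hx (by rintro rfl; simp at hm) hxn h

end ClassNumber

section QuadraticField

theorem NumberField.exists_sq_eq_of_sq_eq {F : Type*} [Field F] {d : ℤ} {α : F} (h : α ^ 2 = d) :
    ∃ γ : 𝓞 F, γ ^ 2 = d ∧ γ = α := by
  have hi : IsIntegral ℤ α := IsIntegral.of_pow two_pos (by
    rw [h, ← eq_intCast (algebraMap ℤ F)]; exact isIntegral_algebraMap)
  obtain ⟨γ, rfl⟩ : ∃ γ : 𝓞 F, (γ : F) = α := ⟨⟨α, hi⟩, rfl⟩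
  exact ⟨γ, RingOfIntegers.ext (by simpa using h), rfl⟩

variable {F : Type*} [Field F] [NumberField F] {γ : 𝓞 F} {d : ℤ}

theorem exists_coe_eq_of_sq_eq (h : finrank ℚ F = 2) (hγ : γ ^ 2 = d) (hd : ¬ IsSquare (d : ℚ))
    (z : F) : ∃ x y : ℚ, z = algebraMap ℚ F x + algebraMap ℚ F y * γ ∧
      Algebra.norm ℚ z = x ^ 2 - d * y ^ 2 ∧ Algebra.trace ℚ F z = 2 * x ∧
      Algebra.trace ℚ F (γ * z) = 2 * d * y := by
  have hγ' : (γ : F) ^ 2 = algebraMap ℚ F d := by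
    simpa using congrArg (algebraMap (𝓞 F) F) hγ
  obtain ⟨x, y, rfl⟩ := exists_eq_add_mul_of_sq_eq h hγ' hd z
  refine ⟨x, y, rfl, norm_of_sq_eq h hγ' hd x y, trace_of_sq_eq h hγ' hd x y, ?_⟩
  have e : γ * (algebraMap ℚ F x + algebraMap ℚ F y * γ) =
      algebraMap ℚ F (d * y) + algebraMap ℚ F x * γ := by
    rw [map_mul, ← hγ']; ring
  rw [e, trace_of_sq_eq h hγ' hd]
  ring

/-- The norm form of a quadratic field, evaluated at an integer that is described by the traces of
`z` and `√d z`. -/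
theorem exists_four_mul_norm_eq (h : finrank ℚ F = 2) (hγ : γ ^ 2 = d) (hd : ¬ IsSquare (d : ℚ))
    (z : 𝓞 F) : ∃ T S : ℤ, d * T ^ 2 - S ^ 2 = 4 * d * Algebra.norm ℤ z := by
  refine ⟨Algebra.trace ℤ (𝓞 F) z, Algebra.trace ℤ (𝓞 F) (γ * z), ?_⟩
  obtain ⟨x, y, -, hN, hT, hS⟩ := exists_coe_eq_of_sq_eq h hγ hd z
  have hT' := Algebra.coe_trace_int (K := F) z
  have hS' := Algebra.coe_trace_int (K := F) (γ * z)
  have hN' := Algebra.coe_norm_int (K := F) z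
  rw [← @Int.cast_inj ℚ]
  push_cast
  rw [hT', hN', hS', RingOfIntegers.coe_eq_algebraMap (γ * z), map_mul, hT, hN, hS]
  ring

theorem exists_of_isPrincipal (h : finrank ℚ F = 2) (hγ : γ ^ 2 = d) (hd : ¬ IsSquare (d : ℚ))
    {I : Ideal (𝓞 F)} (hI : I.IsPrincipal) :
    ∃ T S : ℤ, |d * T ^ 2 - S ^ 2| = 4 * |d| * Ideal.absNorm I := by
  obtain ⟨z, rfl⟩ := hI
  obtain ⟨T, S, e⟩ := exists_four_mul_norm_eq h hγ hd z
  refine ⟨T, S, ?_⟩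
  rw [e, Ideal.submodule_span_eq, Ideal.absNorm_span_singleton, abs_mul, abs_mul]
  simp

theorem abs_discr_le_of_sq_eq (h : finrank ℚ F = 2) (hγ : γ ^ 2 = d) (hd : ¬ IsSquare (d : ℚ)) :
    |discr F| ≤ |4 * d| := by
  have hd0 : d ≠ 0 := by rintro rfl; simp at hd
  refine abs_discr_le_of_traceMatrix h ![1, γ] (by simpa using hd0) ?_
  have hγ' : (γ : F) ^ 2 = algebraMap ℚ F d := by
    simpa using congrArg (algebraMap (𝓞 F) F) hγ
  have t0 := trace_of_sq_eq h hγ' hd 1 0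
  have t1 := trace_of_sq_eq h hγ' hd 0 1
  have t2 := trace_of_sq_eq h hγ' hd d 0
  simp only [map_one, map_zero, zero_mul, add_zero, zero_add, one_mul] at t0 t1 t2
  rw [← hγ', sq] at t2
  rw [det_fin_two]
  simp [Algebra.traceMatrix_apply, Algebra.traceForm_apply, t0, t1, t2]
  ring

theorem eq_top_of_forall_isPrime_of_finrank_eq_two (h : finrank ℚ F = 2) {D B : ℕ}
    (hD : |discr F| ≤ D) (hB : 40 * D < 98 * (B + 1) ^ 2) {H : Subgroup (ClassGroup (𝓞 F))}
    (hP : ∀ P : Ideal (𝓞 F), P.IsPrime → P ≠ ⊥ → Ideal.absNorm P ≤ B → P.ClassMem H) : H = ⊤ := by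
  refine eq_top_of_forall_isPrime (n := 1) (B := B) (D := D) h hD ?_ hP
  have hB' : (40 * D : ℝ) < 98 * (B + 1) ^ 2 := by exact_mod_cast hB
  have hπ := Real.pi_gt_d2
  norm_num [Nat.factorial]
  rw [show 4 / π * (1 / 2 * √(D : ℝ)) = 2 * √D / π by ring, div_lt_iff₀ Real.pi_pos]
  refine lt_of_pow_lt_pow_left₀ 2 (by positivity) ?_
  rw [mul_pow, mul_pow, Real.sq_sqrt (by positivity)]
  nlinarith [mul_nonneg (sq_nonneg ((B : ℝ) + 1)) (by nlinarith : (0 : ℝ) ≤ π ^ 2 - 9.8)]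

/-- If `√d ∈ 𝓞 F` with `d ≡ 3 (mod 4)`, the class of the prime above `2` is a square root of the
trivial class. -/
theorem absNorm_span_two_one_add (h : finrank ℚ F = 2) (hγ : γ ^ 2 = d) (hd : d % 4 = 3) :
    Ideal.absNorm (Ideal.span {2, 1 + γ}) = 2 ∧
      Ideal.span {2, 1 + γ} ^ 2 = Ideal.span {2} ∧
      ∀ P : Ideal (𝓞 F), P.IsPrime → 2 ∈ P → Ideal.span {2, 1 + γ} = P := by
  obtain ⟨k, rfl⟩ : ∃ k, d = 4 * k - 1 := ⟨(d + 1) / 4, by omega⟩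
  have hs : Ideal.span {2, 1 + γ} ^ 2 = Ideal.span {2} :=
    Ideal.span_two_one_add_sq (k := (k : 𝓞 F)) (by rw [hγ]; push_cast; ring)
  have hn : Ideal.absNorm (Ideal.span {2, 1 + γ}) = 2 := by
    have := congrArg Ideal.absNorm hs
    have h4 := absNorm_span_natCast (F := F) 2
    rw [Nat.cast_ofNat] at h4
    rw [map_pow, h4, h] at this
    exact Nat.pow_left_injective two_ne_zero this
  refine ⟨hn, hs, fun P hP h2 => hP.eq_of_irreducible_absNorm (hn ▸ Nat.prime_two) ?_⟩
  refine (Ideal.IsPrime.pow_le_iff two_ne_zero).mp ?_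
  rwa [hs, Ideal.span_singleton_le_iff_mem]

theorem classNumber_of_two_of_sq_eq (h : finrank ℚ F = 2) (hγ : γ ^ 2 = d) (hd : d % 4 = 3)
    (hsq : ¬ IsSquare (d : ℚ)) (hpr : ∀ T S : ℤ, |d * T ^ 2 - S ^ 2| ≠ 8 * |d|) {B : ℕ}
    (hB : 40 * (4 * d.natAbs) < 98 * (B + 1) ^ 2)
    (hP : ∀ H : Subgroup (ClassGroup (𝓞 F)),
      (∀ P : Ideal (𝓞 F), P.IsPrime → P ≠ ⊥ → 2 ∈ P → P.ClassMem H) →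
      ∀ P : Ideal (𝓞 F), P.IsPrime → P ≠ ⊥ → Ideal.absNorm P ≤ B → P.ClassMem H) :
    classNumber F = 2 := by
  obtain ⟨hn, hs, h2⟩ := absNorm_span_two_one_add h hγ hd
  set I := Ideal.span {2, 1 + γ} with hI
  have hI0 : I ∈ (Ideal (𝓞 F))⁰ := mem_nonZeroDivisors_iff_ne_zero.mpr fun h0 => by
    simp [h0] at hn
  have htop : Subgroup.zpowers (ClassGroup.mk0 ⟨I, hI0⟩) = ⊤ := by
    refine eq_top_of_forall_isPrime_of_finrank_eq_two h (D := 4 * d.natAbs) ?_ hB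
      (hP _ fun P hP hP0 h2P => ?_)
    · simpa [abs_mul] using abs_discr_le_of_sq_eq h hγ hsq
    · obtain rfl := h2 P hP h2P
      exact fun _ => Subgroup.mem_zpowers _
  rw [classNumber_eq_orderOf htop]
  refine orderOf_eq_prime ?_ fun h1 => ?_
  · rw [ClassGroup.mk0_pow_eq_one_iff]
    exact hs ▸ ⟨2, rfl⟩
  · rw [ClassGroup.mk0_eq_one_iff] at h1
    obtain ⟨T, S, e⟩ := exists_of_isPrincipal h hγ hsq h1
    refine hpr T S ?_
    rw [e, hn]; push_cast; ring

theorem absNorm_span_intCast_add_intCast_mul (h : finrank ℚ F = 2) (hγ : γ ^ 2 = d)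
    (hd : ¬ IsSquare (d : ℚ)) (a b : ℤ) :
    Ideal.absNorm (Ideal.span {a + b * γ}) = (a ^ 2 - d * b ^ 2).natAbs := by
  refine absNorm_span_singleton_eq _ ?_
  have hγ' : (γ : F) ^ 2 = algebraMap ℚ F d := by
    simpa using congrArg (algebraMap (𝓞 F) F) hγ
  simpa using norm_of_sq_eq h hγ' hd a b

theorem Ideal.classMem_of_sq_sub_eq (h : finrank ℚ F = 2) (hγ : γ ^ 2 = d)
    (hd : ¬ IsSquare (d : ℚ)) {H : Subgroup (ClassGroup (𝓞 F))} {P : Ideal (𝓞 F)}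
    (hP : P.IsPrime) (h0 : P ≠ ⊥) {p : ℕ} (hp : p.Prime) (hpP : (p : 𝓞 F) ∈ P) {a b m : ℤ}
    (hm : ¬ (p : ℤ) ∣ m) (ha : a ^ 2 - d * b ^ 2 = p * m)
    (H' : ∀ Q : Ideal (𝓞 F), Q.IsPrime → Q ≠ ⊥ → (m.natAbs : 𝓞 F) ∈ Q → Q.ClassMem H) :
    P.ClassMem H := by
  have hmem : (a + b * γ) * (a + (-b : ℤ) * γ) ∈ P := by
    have := congrArg (Int.cast : ℤ → 𝓞 F) ha
    push_cast at this
    have e : (a + b * γ) * (a + (-b : ℤ) * γ) = m * p := by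
      push_cast
      rw [mul_comm (m : 𝓞 F), ← this, ← hγ]
      ring
    exact e ▸ P.mul_mem_left _ hpP
  have hm' : ¬ p ∣ m.natAbs := by rwa [← Int.natCast_dvd]
  rcases hP.mem_or_mem hmem with hx | hx
  · refine classMem_of_natCast_mem hP h0 hp hpP hx hm' ?_ H'
    rw [absNorm_span_intCast_add_intCast_mul h hγ hd, ha, Int.natAbs_mul, Int.natAbs_natCast]
  · refine classMem_of_natCast_mem hP h0 hp hpP hx hm' ?_ H'
    rw [absNorm_span_intCast_add_intCast_mul h hγ hd, neg_sq, ha, Int.natAbs_mul,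
      Int.natAbs_natCast]

theorem classNumber_of_sq_eq_neg_five (h : finrank ℚ F = 2) (hα : ∃ α : F, α ^ 2 = -5) :
    classNumber F = 2 := by
  obtain ⟨α, hα⟩ := hα
  obtain ⟨γ, hγ, -⟩ := exists_sq_eq_of_sq_eq (d := -5) (by simpa using hα)
  refine classNumber_of_two_of_sq_eq h hγ (by norm_num) ?_ ?_ (B := 2) (by norm_num) ?_
  · intro hs
    have := hs.nonneg
    norm_num at this
  · intro T S e
    have e : 5 * T ^ 2 + S ^ 2 = 40 := by
      rw [← abs_neg, abs_of_nonneg (by nlinarith [sq_nonneg T, sq_nonneg S])] at e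
      norm_num at e
      linarith
    have hT : T ≤ 2 := by nlinarith
    have hT' : -2 ≤ T := by nlinarith
    have hS : S ≤ 6 := by nlinarith
    have hS' : -6 ≤ S := by nlinarith
    interval_cases T <;> interval_cases S <;> omega
  · intro H h2 P hP h0 hB
    obtain ⟨p, f, hp, hf, hpP, hPf⟩ := exists_absNorm_eq_pow_of_isPrime P h0
    have : p ≤ p ^ f := Nat.le_self_pow hf.ne' p
    obtain rfl : p = 2 := by have := hp.two_le; omega
    exact h2 P hP h0 (by exact_mod_cast hpP)

theorem classNumber_of_sq_eq_one_hundred_fifteen (h : finrank ℚ F = 2)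
    (hα : ∃ α : F, α ^ 2 = 115) : classNumber F = 2 := by
  obtain ⟨α, hα⟩ := hα
  obtain ⟨γ, hγ, -⟩ := exists_sq_eq_of_sq_eq (d := 115) (by simpa using hα)
  have hd : ¬ IsSquare ((115 : ℤ) : ℚ) := by norm_num
  refine classNumber_of_two_of_sq_eq h hγ (by norm_num) hd ?_ (B := 13) (by norm_num) ?_
  · intro T S e
    have key : ∀ t s : ZMod 25, 115 * t ^ 2 - s ^ 2 ≠ 920 ∧ 115 * t ^ 2 - s ^ 2 ≠ -920 := by decide
    rcases abs_eq (by norm_num) |>.mp e with e | e <;>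
      replace e := congrArg (Int.cast : ℤ → ZMod 25) e <;> norm_num at e
    · exact (key T S).1 (by rw [e])
    · exact (key T S).2 (by rw [e])
  · intro H h2 P hP h0 hB
    have h3 : ∀ Q : Ideal (𝓞 F), Q.IsPrime → Q ≠ ⊥ → (3 : 𝓞 F) ∈ Q → Q.ClassMem H :=
      fun Q hQ hQ0 hQ3 => Ideal.classMem_of_sq_sub_eq h hγ hd hQ hQ0 Nat.prime_three
        (by exact_mod_cast hQ3) (a := 11) (b := 1) (m := 2) (by norm_num) (by norm_num)
        (by simpa using h2)
    obtain ⟨p, f, hp, hf, hpP, hPf⟩ := exists_absNorm_eq_pow_of_isPrime P h0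
    have hpB : p ≤ 13 := (Nat.le_self_pow hf.ne' p).trans (hPf ▸ hB)
    have hinert : (∀ t : ZMod p, t ^ 2 ≠ 115) → 3 < p → False := by
      intro ht hp3
      obtain rfl : f = 1 := by
        by_contra h1
        have : p ^ 2 ≤ p ^ f := Nat.pow_le_pow_right hp.pos (by omega)
        have : 4 ^ 2 ≤ p ^ 2 := Nat.pow_le_pow_left hp3 2
        omega
      obtain ⟨φ⟩ := exists_ringHom_of_absNorm_eq hp (hPf.trans (pow_one p))
      exact ht (φ γ) (by rw [← map_pow, hγ, map_intCast, Int.cast_ofNat])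
    interval_cases p <;> norm_num at hp
    · exact h2 P hP h0 (by exact_mod_cast hpP)
    · exact h3 P hP h0 (by exact_mod_cast hpP)
    · exact Ideal.classMem_of_sq_sub_eq h hγ hd hP h0 Nat.prime_five hpP (a := 10) (b := 1)
        (m := -3) (by norm_num) (by norm_num) (by simpa using h3)
    · exact (hinert (by decide) (by norm_num)).elim
    · refine Ideal.classMem_of_sq_sub_eq h hγ hd hP h0 (by norm_num) hpP (a := 4) (b := 1)
        (m := -9) (by norm_num) (by norm_num) fun Q hQ hQ0 hQ9 => h3 Q hQ hQ0 ?_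
      refine hQ.mem_of_pow_mem 2 ?_
      norm_num at hQ9 ⊢
      exact hQ9
    · exact (hinert (by decide) (by norm_num)).elim

end QuadraticField

section QuadraticFieldNegTwentyThree

variable {F : Type*} [Field F] [NumberField F] {ω : 𝓞 F}

theorem two_mul_sub_one_sq {R : Type*} [CommRing R] {ω : R} (hω : ω ^ 2 = ω - 6) :
    (2 * ω - 1) ^ 2 = ((-23 : ℤ) : R) := by
  push_cast
  linear_combination 4 * hω

theorem not_isSquare_neg_twentyThree : ¬ IsSquare ((-23 : ℤ) : ℚ) := fun hs => by
  have := hs.nonneg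
  norm_num at this

theorem norm_and_trace_of_sq_eq_sub_six (h : finrank ℚ F = 2) (hω : ω ^ 2 = ω - 6) (a b : ℤ) :
    Algebra.norm ℚ ((a + b * ω : 𝓞 F) : F) = ((a ^ 2 + a * b + 6 * b ^ 2 : ℤ) : ℚ) ∧
      Algebra.trace ℚ F ((a + b * ω : 𝓞 F) : F) = 2 * a + b := by
  have hγ : ((2 * ω - 1 : 𝓞 F) : F) ^ 2 = algebraMap ℚ F ((-23 : ℤ) : ℚ) := by
    rw [← map_pow, two_mul_sub_one_sq hω]
    simp only [map_intCast]
  have e : ((a + b * ω : 𝓞 F) : F) = algebraMap ℚ F (a + b / 2) +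
      algebraMap ℚ F (b / 2) * ((2 * ω - 1 : 𝓞 F) : F) := by
    simp [map_ofNat (algebraMap (𝓞 F) F) 2]
    ring
  rw [e, norm_of_sq_eq h hγ not_isSquare_neg_twentyThree,
    trace_of_sq_eq h hγ not_isSquare_neg_twentyThree]
  push_cast
  constructor <;> ring

theorem absNorm_span_of_sq_eq_sub_six (h : finrank ℚ F = 2) (hω : ω ^ 2 = ω - 6) (a b : ℤ) :
    Ideal.absNorm (Ideal.span {a + b * ω}) = (a ^ 2 + a * b + 6 * b ^ 2).natAbs :=
  absNorm_span_singleton_eq _ (norm_and_trace_of_sq_eq_sub_six h hω a b).1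

theorem abs_discr_le_of_sq_eq_sub_six (h : finrank ℚ F = 2) (hω : ω ^ 2 = ω - 6) :
    |discr F| ≤ (23 : ℕ) := by
  refine abs_discr_le_of_traceMatrix h ![1, ω] (D := -23) (by norm_num) ?_
  have t0 := (norm_and_trace_of_sq_eq_sub_six h hω 1 0).2
  have t1 := (norm_and_trace_of_sq_eq_sub_six h hω 0 1).2
  have t2 := (norm_and_trace_of_sq_eq_sub_six h hω (-6) 1).2
  have e : ((-6 : ℤ) + (1 : ℤ) * ω : 𝓞 F) = ω * ω := by push_cast; linear_combination -hω
  rw [e] at t2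
  simp at t0 t1 t2
  rw [det_fin_two]
  simp [Algebra.traceMatrix_apply, Algebra.traceForm_apply, t0, t1, t2]
  norm_num

theorem absNorm_span_two_of_sq_eq_sub_six (h : finrank ℚ F = 2) (hω : ω ^ 2 = ω - 6) :
    Ideal.absNorm (Ideal.span {2, ω}) = 2 := by
  have h3 := congrArg Ideal.absNorm (Ideal.span_two_pow_three hω)
  have h8 := absNorm_span_of_sq_eq_sub_six h hω 2 (-1)
  have e : ((2 : ℤ) + (-1 : ℤ) * ω : 𝓞 F) = 2 - ω := by push_cast; ring
  rw [e] at h8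
  rw [map_pow, h8] at h3
  exact Nat.pow_left_injective three_ne_zero h3

theorem not_isPrincipal_span_two_of_sq_eq_sub_six (h : finrank ℚ F = 2) (hω : ω ^ 2 = ω - 6) :
    ¬ (Ideal.span {2, ω}).IsPrincipal := by
  intro hpr
  obtain ⟨T, S, e⟩ := exists_of_isPrincipal h (two_mul_sub_one_sq hω)
    not_isSquare_neg_twentyThree hpr
  have e : 23 * T ^ 2 + S ^ 2 = 184 := by
    rw [absNorm_span_two_of_sq_eq_sub_six h hω, ← abs_neg,
      abs_of_nonneg (by nlinarith [sq_nonneg T, sq_nonneg S])] at e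
    norm_num at e
    linarith
  have hT : T ≤ 2 := by nlinarith
  have hT' : -2 ≤ T := by nlinarith
  have hS : S ≤ 13 := by nlinarith
  have hS' : -13 ≤ S := by nlinarith
  interval_cases T <;> interval_cases S <;> omega

theorem orderOf_mk0_span_two_of_sq_eq_sub_six (h : finrank ℚ F = 2) (hω : ω ^ 2 = ω - 6)
    (hI : Ideal.span {2, ω} ∈ (Ideal (𝓞 F))⁰) :
    orderOf (ClassGroup.mk0 ⟨Ideal.span {2, ω}, hI⟩) = 3 := by
  refine orderOf_eq_prime ?_ fun h1 => ?_
  · rw [ClassGroup.mk0_pow_eq_one_iff]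
    exact Ideal.span_two_pow_three hω ▸ ⟨2 - ω, rfl⟩
  · exact not_isPrincipal_span_two_of_sq_eq_sub_six h hω ((ClassGroup.mk0_eq_one_iff hI).mp h1)

theorem classNumber_of_sq_eq_sub_six (h : finrank ℚ F = 2) (hω : ω ^ 2 = ω - 6) :
    classNumber F = 3 := by
  have hn := absNorm_span_two_of_sq_eq_sub_six h hω
  have hI : Ideal.span {2, ω} ∈ (Ideal (𝓞 F))⁰ := mem_nonZeroDivisors_iff_ne_zero.mpr fun h0 => by
    simp [h0] at hn
  suffices htop : Subgroup.zpowers (ClassGroup.mk0 ⟨Ideal.span {2, ω}, hI⟩) = ⊤ by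
    rw [classNumber_eq_orderOf htop, orderOf_mk0_span_two_of_sq_eq_sub_six h hω]
  refine eq_top_of_forall_isPrime_of_finrank_eq_two h (abs_discr_le_of_sq_eq_sub_six h hω) (B := 3)
    (by norm_num) fun P hP h0 hB => ?_
  set H := Subgroup.zpowers (ClassGroup.mk0 ⟨Ideal.span {2, ω}, hI⟩)
  have hIH : (Ideal.span {2, ω}).ClassMem H := fun _ => Subgroup.mem_zpowers _
  have h2 : ∀ Q : Ideal (𝓞 F), Q.IsPrime → Q ≠ ⊥ → (2 : 𝓞 F) ∈ Q → Q.ClassMem H := by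
    intro Q hQ hQ0 hQ2
    have hle : Ideal.span {2, ω - 1} * Ideal.span {2, ω} ≤ Q := by
      rwa [Ideal.span_two_mul_span_two hω, Ideal.span_singleton_le_iff_mem]
    have hn' : Ideal.absNorm (Ideal.span {2, ω - 1}) = 2 := by
      have e := congrArg Ideal.absNorm (Ideal.span_two_mul_span_two hω)
      have h4 := absNorm_span_natCast (F := F) 2
      rw [Nat.cast_ofNat] at h4
      rw [map_mul, h4, h, hn] at e
      omega
    rcases hQ.mul_le.mp hle with hle | hle
    · rw [← hQ.eq_of_irreducible_absNorm (hn' ▸ Nat.prime_two) hle]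
      exact .of_mul_eq_span two_ne_zero (Ideal.span_two_mul_span_two hω) hIH
    · rwa [← hQ.eq_of_irreducible_absNorm (hn ▸ Nat.prime_two) hle]
  obtain ⟨p, f, hp, hf, hpP, hPf⟩ := exists_absNorm_eq_pow_of_isPrime P h0
  have hpB : p ≤ 3 := (Nat.le_self_pow hf.ne' p).trans (hPf ▸ hB)
  have hp2 := hp.two_le
  interval_cases p
  · exact h2 P hP h0 (by exact_mod_cast hpP)
  · have hmem : ((0 : ℤ) + (1 : ℤ) * ω) * ((-1 : ℤ) + (1 : ℤ) * ω) ∈ P := by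
      have e : ((0 : ℤ) + (1 : ℤ) * ω) * ((-1 : ℤ) + (1 : ℤ) * ω) = (-2) * ((3 : ℕ) : 𝓞 F) := by
        push_cast; linear_combination hω
      exact e ▸ P.mul_mem_left _ hpP
    rcases hP.mem_or_mem hmem with hx | hx <;>
      exact Ideal.classMem_of_natCast_mem hP h0 hp hpP hx (m := 2) (by norm_num)
        (by rw [absNorm_span_of_sq_eq_sub_six h hω]; norm_num) (by simpa using h2)

theorem exists_sq_eq_sub_six_of_sq_eq {β : F} (hβ : β ^ 2 = -23) :
    ∃ ω : 𝓞 F, ω ^ 2 = ω - 6 ∧ 2 * (ω : F) - 1 = β := by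
  have e : ((1 + β) / 2) * ((1 + β) / 2 - 1) = ((-6 : ℤ) : F) := by
    push_cast
    linear_combination hβ / 4
  have hi : IsIntegral ℤ ((1 + β) / 2) := by
    refine ⟨.X ^ 2 - .X + 6, by monicity!, ?_⟩
    simp
    push_cast at e
    linear_combination e
  obtain ⟨ω, hω⟩ : ∃ ω : 𝓞 F, (ω : F) = (1 + β) / 2 := ⟨⟨_, hi⟩, rfl⟩
  refine ⟨ω, RingOfIntegers.ext ?_, by rw [hω]; ring⟩
  rw [← hω] at e
  push_cast at e
  simp [map_ofNat (algebraMap (𝓞 F) F) 6]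
  linear_combination e

end QuadraticFieldNegTwentyThree

section Biquadratic

open IntermediateField Polynomial in
theorem finrank_adjoin_of_sq_eq {F L : Type*} [Field F] [Field L] [Algebra F L] {γ : L} {c : F}
    (hγ : γ ^ 2 = algebraMap F L c) (hc : ¬ IsSquare c) : finrank F F⟮γ⟯ = 2 := by
  have hi : Irreducible (X ^ 2 - C c) :=
    X_pow_sub_C_irreducible_of_prime Nat.prime_two fun b hb => hc ⟨b, by rw [← hb, sq]⟩
  have hm := minpoly.eq_of_irreducible_of_monic (x := γ) hi (by simp [hγ])
    (monic_X_pow_sub_C c two_ne_zero)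
  have hint : IsIntegral F γ := ⟨X ^ 2 - C c, monic_X_pow_sub_C c two_ne_zero, by simp [hγ]⟩
  rw [adjoin.finrank hint, ← hm, natDegree_X_pow_sub_C]

variable {K : Type*} [Field K] [NumberField K]

open IntermediateField in
theorem finrank_over_adjoin_of_sq_eq (hK : finrank ℚ K = 4) {α : K} {c : ℚ}
    (hα : α ^ 2 = algebraMap ℚ K c) (hc : ¬ IsSquare c) : finrank ℚ⟮α⟯ K = 2 := by
  have h2 := finrank_adjoin_of_sq_eq hα hc
  have := finrank_mul_finrank ℚ ℚ⟮α⟯ K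
  rw [h2, hK] at this
  omega

open IntermediateField in
/-- Norm and trace of an element of the biquadratic field `ℚ(√c, √e)`. -/
theorem norm_and_trace_of_biquadratic (hK : finrank ℚ K = 4) {α β : K} {c e : ℚ}
    (hα : α ^ 2 = algebraMap ℚ K c) (hβ : β ^ 2 = algebraMap ℚ K e) (hc : ¬ IsSquare c)
    (he : ¬ IsSquare e) (hec : ¬ IsSquare (e * c)) (x y z w : ℚ) :
    Algebra.norm ℚ (x + y * α + (z + w * α) * β : K) =
        (x ^ 2 + c * y ^ 2 - e * (z ^ 2 + c * w ^ 2)) ^ 2 -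
          c * (2 * x * y - 2 * e * z * w) ^ 2 ∧
      Algebra.trace ℚ K (x + y * α + (z + w * α) * β) = 4 * x := by
  have h1 := finrank_adjoin_of_sq_eq hα hc
  have h2 := finrank_over_adjoin_of_sq_eq hK hα hc
  set g : ℚ⟮α⟯ := AdjoinSimple.gen ℚ α
  have hgα : algebraMap ℚ⟮α⟯ K g = α := AdjoinSimple.algebraMap_gen ℚ α
  have hg : g ^ 2 = algebraMap ℚ ℚ⟮α⟯ c := by
    apply (algebraMap ℚ⟮α⟯ K).injective
    rw [map_pow, hgα, hα, ← IsScalarTower.algebraMap_apply]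
  have he' : ¬ IsSquare (algebraMap ℚ ℚ⟮α⟯ e) := fun hs =>
    (isSquare_or_of_isSquare_algebraMap two_ne_zero h1 hg hc hs).elim he hec
  have hβ' : β ^ 2 = algebraMap ℚ⟮α⟯ K (algebraMap ℚ ℚ⟮α⟯ e) := by
    rw [hβ, ← IsScalarTower.algebraMap_apply]
  have hz : (x + y * α + (z + w * α) * β : K) =
      algebraMap ℚ⟮α⟯ K (algebraMap ℚ _ x + algebraMap ℚ _ y * g) +
        algebraMap ℚ⟮α⟯ K (algebraMap ℚ _ z + algebraMap ℚ _ w * g) * β := by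
    simp only [map_add, map_mul, hgα, eq_ratCast, map_ratCast]
  rw [hz, ← Algebra.norm_norm (S := ℚ⟮α⟯), ← Algebra.trace_trace (S := ℚ⟮α⟯),
    norm_of_sq_eq h2 hβ' he', trace_of_sq_eq h2 hβ' he']
  constructor
  · rw [← norm_of_sq_eq h1 hg hc]
    congr 1
    simp only [map_sub, map_add, map_mul, map_pow, map_ofNat]
    linear_combination
      (algebraMap ℚ ℚ⟮α⟯ y ^ 2 - algebraMap ℚ ℚ⟮α⟯ e * algebraMap ℚ ℚ⟮α⟯ w ^ 2) * hg
  · have e2 : 2 * (algebraMap ℚ ℚ⟮α⟯ x + algebraMap ℚ ℚ⟮α⟯ y * g) =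
        algebraMap ℚ ℚ⟮α⟯ (2 * x) + algebraMap ℚ ℚ⟮α⟯ (2 * y) * g := by
      simp only [map_mul, map_ofNat]
      ring
    rw [e2, trace_of_sq_eq h1 hg hc]
    ring

variable {θ ω : 𝓞 K}

theorem norm_and_trace_of_integral_combination (hK : finrank ℚ K = 4) (hθ : θ ^ 2 = -5)
    (hω : ω ^ 2 = ω - 6) (x y z w : ℤ) :
    Algebra.norm ℚ ((x + y * θ + z * ω + w * (θ * ω) : 𝓞 K) : K) =
        (((x ^ 2 - 5 * y ^ 2 + (x * z - 5 * y * w) + 6 * (z ^ 2 - 5 * w ^ 2)) ^ 2 +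
          5 * (2 * x * y + x * w + y * z + 12 * z * w) ^ 2 : ℤ) : ℚ) ∧
      Algebra.trace ℚ K ((x + y * θ + z * ω + w * (θ * ω) : 𝓞 K) : K) =
        ((4 * x + 2 * z : ℤ) : ℚ) := by
  have hα : (θ : K) ^ 2 = algebraMap ℚ K (-5 : ℤ) := by
    rw [← map_pow, hθ]
    simp [map_ofNat (algebraMap (𝓞 K) K) 5]
  have hβ : ((2 * ω - 1 : 𝓞 K) : K) ^ 2 = algebraMap ℚ K (-23 : ℤ) := by
    rw [← map_pow, two_mul_sub_one_sq hω]
    simp only [map_intCast]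
  have hc : ¬ IsSquare ((-5 : ℤ) : ℚ) := fun hs => by
    have := hs.nonneg
    norm_num at this
  have hz : ((x + y * θ + z * ω + w * (θ * ω) : 𝓞 K) : K) =
      ((x + z / 2 : ℚ) : K) + ((y + w / 2 : ℚ) : K) * (θ : K) +
        (((z / 2 : ℚ) : K) + ((w / 2 : ℚ) : K) * (θ : K)) * ((2 * ω - 1 : 𝓞 K) : K) := by
    simp [map_ofNat (algebraMap (𝓞 K) K) 2]
    ring
  obtain ⟨hn, ht⟩ := norm_and_trace_of_biquadratic hK hα hβ hc not_isSquare_neg_twentyThree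
    (by norm_num) (x + z / 2) (y + w / 2) (z / 2) (w / 2)
  rw [hz, hn, ht]
  push_cast
  constructor <;> ring

theorem absNorm_span_integral_combination (hK : finrank ℚ K = 4) (hθ : θ ^ 2 = -5)
    (hω : ω ^ 2 = ω - 6) (x y z w : ℤ) :
    Ideal.absNorm (Ideal.span {x + y * θ + z * ω + w * (θ * ω)}) =
      ((x ^ 2 - 5 * y ^ 2 + (x * z - 5 * y * w) + 6 * (z ^ 2 - 5 * w ^ 2)) ^ 2 +
          5 * (2 * x * y + x * w + y * z + 12 * z * w) ^ 2).natAbs :=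
  absNorm_span_singleton_eq _ (norm_and_trace_of_integral_combination hK hθ hω x y z w).1

theorem abs_discr_le_of_biquadratic (hK : finrank ℚ K = 4) (hθ : θ ^ 2 = -5)
    (hω : ω ^ 2 = ω - 6) : |discr K| ≤ 460 ^ 2 := by
  refine abs_discr_le_of_traceMatrix hK ![1, θ, ω, θ * ω] (D := 460 ^ 2) (by norm_num) ?_
  have key : ∀ (u : 𝓞 K) (x y z w : ℤ), u = x + y * θ + z * ω + w * (θ * ω) →
      Algebra.trace ℚ K (u : K) = ((4 * x + 2 * z : ℤ) : ℚ) := by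
    rintro u x y z w rfl
    exact (norm_and_trace_of_integral_combination hK hθ hω x y z w).2
  have hM : Algebra.traceMatrix ℚ (fun i => ((![1, θ, ω, θ * ω] i : 𝓞 K) : K)) =
      !![4, 0, 2, 0; 0, -20, 0, -10; 2, 0, -22, 0; 0, -10, 0, 110] := by
    ext i j
    rw [Algebra.traceMatrix_apply, Algebra.traceForm_apply, ← map_mul]
    fin_cases i <;> fin_cases j
    · rw [key _ 1 0 0 0 (by simp)]; norm_num
    · rw [key _ 0 1 0 0 (by simp)]; norm_num
    · rw [key _ 0 0 1 0 (by simp)]; norm_num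
    · rw [key _ 0 0 0 1 (by simp)]; norm_num
    · rw [key _ 0 1 0 0 (by simp)]; norm_num
    · rw [key _ (-5) 0 0 0 (by simp; linear_combination hθ)]; norm_num
    · rw [key _ 0 0 0 1 (by simp)]; norm_num
    · rw [key _ 0 0 (-5) 0 (by simp; linear_combination ω * hθ)]; norm_num
    · rw [key _ 0 0 1 0 (by simp)]; norm_num
    · rw [key _ 0 0 0 1 (by simp [mul_comm])]; norm_num
    · rw [key _ (-6) 0 1 0 (by simp; linear_combination hω)]; norm_num
    · rw [key _ 0 (-6) 0 1 (by simp; linear_combination θ * hω)]; norm_num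
    · rw [key _ 0 0 0 1 (by simp)]; norm_num
    · rw [key _ 0 0 (-5) 0 (by simp; linear_combination ω * hθ)]; norm_num
    · rw [key _ 0 (-6) 0 1 (by simp; linear_combination θ * hω)]; norm_num
    · rw [key _ 30 0 (-5) 0 (by simp; linear_combination ω ^ 2 * hθ - 5 * hω)]; norm_num
  rw [hM]
  simp [det_succ_row_zero, Fin.sum_univ_succ, Fin.succAbove]
  norm_num

/-- Minkowski's bound for a quartic field of discriminant at most `460 ^ 2`. -/
theorem eq_top_of_forall_isPrime_of_biquadratic (hK : finrank ℚ K = 4) (hD : |discr K| ≤ 460 ^ 2)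
    {H : Subgroup (ClassGroup (𝓞 K))}
    (h : ∀ P : Ideal (𝓞 K), P.IsPrime → P ≠ ⊥ → Ideal.absNorm P ≤ 69 → P.ClassMem H) : H = ⊤ := by
  refine eq_top_of_forall_isPrime (n := 2) (B := 69) (D := 460 ^ 2) hK hD ?_ h
  have hs : √((460 ^ 2 : ℤ) : ℝ) = 460 := by
    rw [Real.sqrt_eq_iff_mul_self_eq] <;> norm_num
  rw [hs, div_pow, div_mul_eq_mul_div, div_lt_iff₀ (pow_pos Real.pi_pos 2)]
  norm_num [Nat.factorial]
  nlinarith [Real.pi_gt_d4]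

end Biquadratic

section BiquadraticClassNumber

variable {K : Type*} [Field K] [NumberField K] {θ ω : 𝓞 K}

theorem absNorm_span_triple (hK : finrank ℚ K = 4) (hθ : θ ^ 2 = -5) (hω : ω ^ 2 = ω - 6) :
    Ideal.absNorm (Ideal.span {2, 1 + θ, ω}) = 2 ∧
      Ideal.absNorm (Ideal.span {2, 1 + θ, ω - 1}) = 2 := by
  have hA : Ideal.absNorm (Ideal.span {2, 1 + θ, ω}) = 2 := by
    have h6 : Ideal.span {2, 1 + θ, ω} ^ 6 = Ideal.span {2 - ω} := by
      rw [← Ideal.span_two_pow_three hω, ← Ideal.span_triple_sq hθ hω, ← pow_mul]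
    have hn := absNorm_span_integral_combination hK hθ hω 2 0 (-1) 0
    have e : ((2 : ℤ) + (0 : ℤ) * θ + (-1 : ℤ) * ω + (0 : ℤ) * (θ * ω) : 𝓞 K) = 2 - ω := by
      push_cast
      ring
    rw [e, ← h6, map_pow] at hn
    exact Nat.pow_left_injective (by norm_num : 6 ≠ 0) hn
  refine ⟨hA, ?_⟩
  have hn := absNorm_span_integral_combination hK hθ hω 7 15 (-14) 0
  have e : ((7 : ℤ) + (15 : ℤ) * θ + (-14 : ℤ) * ω + (0 : ℤ) * (θ * ω) : 𝓞 K) =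
      15 * θ - 14 * ω + 7 := by
    push_cast
    ring
  rw [e, ← Ideal.span_triple_mul_span_triple hθ hω, map_mul, hA] at hn
  norm_num at hn
  omega

theorem Ideal.span_triple_le_or_of_two_mem {R : Type*} [CommRing R] {θ ω : R} (hθ : θ ^ 2 = -5)
    (hω : ω ^ 2 = ω - 6) {P : Ideal R}
    (hP : P.IsPrime) (h2 : (2 : R) ∈ P) :
    Ideal.span {2, 1 + θ, ω} ≤ P ∨ Ideal.span {2, 1 + θ, ω - 1} ≤ P := by
  have h1 : 1 + θ ∈ P := by
    refine hP.mem_of_pow_mem 2 ?_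
    have e : (1 + θ) ^ 2 = (θ - 2) * 2 := by linear_combination hθ
    exact e ▸ P.mul_mem_left _ h2
  have h3 : ω * (ω - 1) ∈ P := by
    have e : ω * (ω - 1) = (-3) * 2 := by linear_combination hω
    exact e ▸ P.mul_mem_left _ h2
  refine (hP.mem_or_mem h3).imp (fun h => ?_) (fun h => ?_) <;>
  · rw [Ideal.span_le]
    rintro x (rfl | rfl | rfl) <;> assumption

/-- If the norm of `x + yθ + zω + wθω` is `pm` then one of its conjugates belongs to each prime
ideal above `p`. -/
theorem exists_mem_of_norm_form_eq {R : Type*} [CommRing R] {θ ω : R} (hθ : θ ^ 2 = -5)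
    (hω : ω ^ 2 = ω - 6) {P : Ideal R} (hP : P.IsPrime) {p : ℕ} (hpP : (p : R) ∈ P) (x y z w m : ℤ)
    (h : (x ^ 2 - 5 * y ^ 2 + (x * z - 5 * y * w) + 6 * (z ^ 2 - 5 * w ^ 2)) ^ 2 +
          5 * (2 * x * y + x * w + y * z + 12 * z * w) ^ 2 = p * m) :
    ∃ x' y' z' w' : ℤ, (x' + y' * θ + z' * ω + w' * (θ * ω) : R) ∈ P ∧
      (x' ^ 2 - 5 * y' ^ 2 + (x' * z' - 5 * y' * w') + 6 * (z' ^ 2 - 5 * w' ^ 2)) ^ 2 +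
          5 * (2 * x' * y' + x' * w' + y' * z' + 12 * z' * w') ^ 2 = p * m := by
  have key : ∀ x y z w : ℤ, (x + y * θ + z * ω + w * (θ * ω) : R) *
      ((x + z : ℤ) + (y + w : ℤ) * θ + (-z : ℤ) * ω + (-w : ℤ) * (θ * ω)) =
      ((x ^ 2 - 5 * y ^ 2 + (x * z - 5 * y * w) + 6 * (z ^ 2 - 5 * w ^ 2) : ℤ) : R) +
        ((2 * x * y + x * w + y * z + 12 * z * w : ℤ) : R) * θ := by
    intro x y z w
    push_cast
    linear_combination -(z + w * θ) ^ 2 * hω + (y ^ 2 + y * w + 6 * w ^ 2 : R) * hθ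
  have hmem : (x + y * θ + z * ω + w * (θ * ω) : R) *
      ((x + z : ℤ) + (y + w : ℤ) * θ + (-z : ℤ) * ω + (-w : ℤ) * (θ * ω)) *
      ((x + (-y : ℤ) * θ + z * ω + (-w : ℤ) * (θ * ω) : R) *
      ((x + z : ℤ) + (-y + -w : ℤ) * θ + (-z : ℤ) * ω + (- -w : ℤ) * (θ * ω))) ∈ P := by
    have e := congrArg (Int.cast : ℤ → R) h
    rw [key, key]
    have e' : ∀ U V : R, (U + V * θ) * (U + -V * θ) = U ^ 2 + 5 * V ^ 2 := by
      intro U V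
      linear_combination -V ^ 2 * hθ
    have := P.mul_mem_left (m : R) hpP
    convert this using 1
    push_cast at e ⊢
    rw [mul_comm (m : R), ← e, ← e']
    ring
  rcases hP.mem_or_mem hmem with h' | h' <;> rcases hP.mem_or_mem h' with h' | h'
  · exact ⟨_, _, _, _, h', h⟩
  · exact ⟨_, _, _, _, h', by rw [← h]; ring⟩
  · exact ⟨_, _, _, _, h', by rw [← h]; ring⟩
  · exact ⟨_, _, _, _, h', by rw [← h]; ring⟩

theorem Ideal.classMem_of_norm_form_eq (hK : finrank ℚ K = 4) (hθ : θ ^ 2 = -5)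
    (hω : ω ^ 2 = ω - 6) {H : Subgroup (ClassGroup (𝓞 K))} {P : Ideal (𝓞 K)}
    (hP : P.IsPrime) (h0 : P ≠ ⊥) {p m : ℕ} (hp : p.Prime) (hpP : (p : 𝓞 K) ∈ P)
    (hm : ¬ p ∣ m) (x y z w : ℤ)
    (h : (x ^ 2 - 5 * y ^ 2 + (x * z - 5 * y * w) + 6 * (z ^ 2 - 5 * w ^ 2)) ^ 2 +
          5 * (2 * x * y + x * w + y * z + 12 * z * w) ^ 2 = p * m)
    (H' : ∀ Q : Ideal (𝓞 K), Q.IsPrime → Q ≠ ⊥ → (m : 𝓞 K) ∈ Q → Q.ClassMem H) :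
    P.ClassMem H := by
  obtain ⟨x', y', z', w', hx, h'⟩ := exists_mem_of_norm_form_eq hθ hω hP hpP x y z w m h
  refine classMem_of_natCast_mem hP h0 hp hpP hx hm ?_ H'
  rw [absNorm_span_integral_combination hK hθ hω, h']
  rfl

theorem zpowers_mk0_span_triple_eq_top (hK : finrank ℚ K = 4) (hθ : θ ^ 2 = -5)
    (hω : ω ^ 2 = ω - 6) (hA : Ideal.span {2, 1 + θ, ω} ∈ (Ideal (𝓞 K))⁰) :
    Subgroup.zpowers (ClassGroup.mk0 ⟨_, hA⟩) = ⊤ := by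
  refine eq_top_of_forall_isPrime_of_biquadratic hK (abs_discr_le_of_biquadratic hK hθ hω)
    fun P hP h0 hB => ?_
  set H := Subgroup.zpowers (ClassGroup.mk0 ⟨_, hA⟩)
  have hAH : (Ideal.span {2, 1 + θ, ω}).ClassMem H := fun _ => Subgroup.mem_zpowers _
  obtain ⟨nA, nB⟩ := absNorm_span_triple hK hθ hω
  have h2 : ∀ Q : Ideal (𝓞 K), Q.IsPrime → Q ≠ ⊥ → (2 : 𝓞 K) ∈ Q → Q.ClassMem H := by
    intro Q hQ hQ0 hQ2
    rcases Ideal.span_triple_le_or_of_two_mem hθ hω hQ hQ2 with hle | hle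
    · rwa [← hQ.eq_of_irreducible_absNorm (nA ▸ Nat.prime_two) hle]
    · rw [← hQ.eq_of_irreducible_absNorm (nB ▸ Nat.prime_two) hle]
      refine .of_mul_eq_span (fun hδ => ?_) (Ideal.span_triple_mul_span_triple hθ hω) hAH
      have := congrArg Ideal.absNorm (Ideal.span_triple_mul_span_triple hθ hω)
      rw [hδ, map_mul, nA, nB] at this
      simp at this
  have h3 : ∀ Q : Ideal (𝓞 K), Q.IsPrime → Q ≠ ⊥ → (3 : 𝓞 K) ∈ Q → Q.ClassMem H :=
    fun Q hQ hQ0 hQ3 => Ideal.classMem_of_norm_form_eq hK hθ hω hQ hQ0 Nat.prime_three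
      (by exact_mod_cast hQ3) (m := 2) (by norm_num) 0 (-1) (-1) 0 (by norm_num) (by simpa using h2)
  have h6 : ∀ m k : ℕ, m ∣ 6 ^ k →
      ∀ Q : Ideal (𝓞 K), Q.IsPrime → Q ≠ ⊥ → (m : 𝓞 K) ∈ Q → Q.ClassMem H := by
    rintro m k ⟨c, hc⟩ Q hQ hQ0 hQm
    have hmem : (2 * 3 : 𝓞 K) ∈ Q := by
      refine hQ.mem_of_pow_mem k ?_
      have e : (2 * 3 : 𝓞 K) ^ k = c * m := by
        rw [mul_comm (c : 𝓞 K)]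
        norm_num
        exact_mod_cast hc
      exact e ▸ Q.mul_mem_left _ hQm
    exact (hQ.mem_or_mem hmem).elim (h2 Q hQ hQ0) (h3 Q hQ hQ0)
  obtain ⟨p, f, hp, hf, hpP, hPf⟩ := exists_absNorm_eq_pow_of_isPrime P h0
  have hpB : p ≤ 69 := (Nat.le_self_pow hf.ne' p).trans (hPf ▸ hB)
  have hf1 : 8 < p → f = 1 := by
    intro hp8
    by_contra h1
    have : p ^ 2 ≤ p ^ f := Nat.pow_le_pow_right hp.pos (by omega)
    have : 9 ^ 2 ≤ p ^ 2 := Nat.pow_le_pow_left hp8 2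
    omega
  have hf2 : 4 < p → f ≤ 2 := by
    intro hp4
    by_contra h1
    have : p ^ 3 ≤ p ^ f := Nat.pow_le_pow_right hp.pos (by omega)
    have : 5 ^ 3 ≤ p ^ 3 := Nat.pow_le_pow_left hp4 3
    omega
  have hsplit : (∀ t : ZMod p, t ^ 2 ≠ -5) ∨ (∀ s : ZMod p, s ^ 2 ≠ s - 6) → f ≠ 1 := by
    rintro ht rfl
    obtain ⟨φ⟩ := exists_ringHom_of_absNorm_eq hp (hPf.trans (pow_one p))
    rcases ht with ht | hs
    · exact ht (φ θ) (by rw [← map_pow, hθ, map_neg]; exact congrArg _ (map_ofNat φ 5))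
    · exact hs (φ ω) (by rw [← map_pow, hω, map_sub]; exact congrArg _ (map_ofNat φ 6))
  have hexcl : 8 < p → ¬ ((∀ t : ZMod p, t ^ 2 ≠ -5) ∨ (∀ s : ZMod p, s ^ 2 ≠ s - 6)) :=
    fun h8 hts => hsplit hts (hf1 h8)
  by_cases hp2 : p = 2
  · subst hp2
    exact h2 P hP h0 (by exact_mod_cast hpP)
  by_cases hp3 : p = 3
  · subst hp3
    exact h3 P hP h0 (by exact_mod_cast hpP)
  by_cases hp5 : p = 5
  · subst hp5
    obtain rfl : f = 2 := by
      have := hsplit (.inr (by decide))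
      have := hf2 (by norm_num)
      omega
    have hx : θ ∈ P := by
      refine hP.mem_of_pow_mem 2 ?_
      rw [hθ, neg_mem_iff]
      exact_mod_cast hpP
    refine Ideal.classMem_of_mem (by norm_num) hPf hx (m := 1) one_ne_zero ?_
      (h6 1 1 (by norm_num))
    simpa using absNorm_span_integral_combination hK hθ hω 0 1 0 0
  by_cases hp7 : p = 7
  · subst hp7
    obtain rfl : f = 2 := by
      have := hsplit (.inr (by decide))
      have := hf2 (by norm_num)
      omega
    have hmem : ((3 : ℤ) + (1 : ℤ) * θ + (0 : ℤ) * ω + (0 : ℤ) * (θ * ω)) *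
        ((3 : ℤ) + (-1 : ℤ) * θ + (0 : ℤ) * ω + (0 : ℤ) * (θ * ω)) ∈ P := by
      have e : ((3 : ℤ) + (1 : ℤ) * θ + (0 : ℤ) * ω + (0 : ℤ) * (θ * ω)) *
          ((3 : ℤ) + (-1 : ℤ) * θ + (0 : ℤ) * ω + (0 : ℤ) * (θ * ω)) = 2 * ((7 : ℕ) : 𝓞 K) := by
        push_cast
        linear_combination -hθ
      exact e ▸ P.mul_mem_left _ hpP
    rcases hP.mem_or_mem hmem with hx | hx <;>
      exact Ideal.classMem_of_mem (by norm_num) hPf hx (m := 4) (by norm_num)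
        (by rw [absNorm_span_integral_combination hK hθ hω]; norm_num) (h6 4 2 (by norm_num))
  have hp' : p = 23 ∨ p = 29 ∨ p = 41 ∨ p = 47 := by
    have h8 : 8 < p := by
      by_contra h8
      interval_cases p <;> contradiction
    specialize hexcl h8
    clear hsplit hf1 hf2 hpP hPf
    interval_cases p <;> first
      | (norm_num at hp; done)
      | exact (hexcl (.inl (by decide))).elim
      | exact (hexcl (.inr (by decide))).elim
      | (simp; done)
  rcases hp' with rfl | rfl | rfl | rfl
  · exact Ideal.classMem_of_norm_form_eq hK hθ hω hP h0 hp hpP (m := 12) (by norm_num)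
      (-4) 0 0 (-1) (by norm_num) (h6 12 2 (by norm_num))
  · exact Ideal.classMem_of_norm_form_eq hK hθ hω hP h0 hp hpP (m := 16) (by norm_num)
      (-4) 0 1 (-1) (by norm_num) (h6 16 4 (by norm_num))
  · exact Ideal.classMem_of_norm_form_eq hK hθ hω hP h0 hp hpP (m := 4) (by norm_num)
      (-4) (-3) (-2) 1 (by norm_num) (h6 4 2 (by norm_num))
  · exact Ideal.classMem_of_norm_form_eq hK hθ hω hP h0 hp hpP (m := 2) (by norm_num)
      (-1) (-3) 3 0 (by norm_num) (h6 2 1 (by norm_num))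

end BiquadraticClassNumber

section RelNorm

variable {F K : Type*} [Field F] [NumberField F] [Field K] [NumberField K] [Algebra F K]

theorem Ideal.IsPrincipal.relNorm {I : Ideal (𝓞 K)} (hI : I.IsPrincipal) :
    (Ideal.relNorm (𝓞 F) I).IsPrincipal := by
  obtain ⟨x, rfl⟩ := hI
  rw [Ideal.submodule_span_eq, Ideal.relNorm_singleton]
  exact ⟨_, rfl⟩

theorem isPrincipal_pow_finrank_of_isPrincipal_map {J : Ideal (𝓞 F)}
    (hJ : (J.map (algebraMap (𝓞 F) (𝓞 K))).IsPrincipal) : (J ^ finrank F K).IsPrincipal := by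
  have h := Ideal.IsPrincipal.relNorm (F := F) hJ
  rwa [Ideal.relNorm_algebraMap, ← IsFractionRing.finrank_eq (𝓞 F) F (𝓞 K) K] at h

end RelNorm

section BiquadraticLowerBound

open IntermediateField

variable {K : Type*} [Field K] [NumberField K] {θ ω : 𝓞 K}

theorem not_isPrincipal_span_two_of_biquadratic (hK : finrank ℚ K = 4) (hω : ω ^ 2 = ω - 6) :
    ¬ (Ideal.span {2, ω}).IsPrincipal := by
  intro hp
  have hβ : (2 * (ω : K) - 1) ^ 2 = algebraMap ℚ K (-23 : ℤ) := by
    simpa [map_ofNat] using congrArg (algebraMap (𝓞 K) K) (two_mul_sub_one_sq hω)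
  set β : K := 2 * (ω : K) - 1 with hβ'
  have h2 := finrank_adjoin_of_sq_eq hβ not_isSquare_neg_twentyThree
  have h2K := finrank_over_adjoin_of_sq_eq hK hβ not_isSquare_neg_twentyThree
  have hg : AdjoinSimple.gen ℚ β ^ 2 = -23 :=
    (algebraMap ℚ⟮β⟯ K).injective <| by
      rw [map_pow, AdjoinSimple.algebraMap_gen, hβ, map_intCast, map_neg, map_ofNat]; norm_num
  obtain ⟨ω', hω', e⟩ := exists_sq_eq_sub_six_of_sq_eq hg
  have hωω' : algebraMap (𝓞 ℚ⟮β⟯) (𝓞 K) ω' = ω := by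
    apply RingOfIntegers.ext
    have := congrArg (algebraMap ℚ⟮β⟯ K) e
    rw [AdjoinSimple.algebraMap_gen, map_sub, map_mul, map_one, map_ofNat] at this
    replace this := sub_left_inj.mp (this.trans hβ')
    exact mul_left_cancel₀ two_ne_zero this
  have hmap : (Ideal.span {2, ω'}).map (algebraMap (𝓞 ℚ⟮β⟯) (𝓞 K)) = Ideal.span {2, ω} := by
    rw [Ideal.map_span, Set.image_pair, map_ofNat, hωω']
  have hsq := isPrincipal_pow_finrank_of_isPrincipal_map (hmap ▸ hp)
  rw [h2K] at hsq
  have hI : Ideal.span {2, ω'} ∈ (Ideal (𝓞 ℚ⟮β⟯))⁰ := by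
    refine mem_nonZeroDivisors_iff_ne_zero.mpr fun h0 => ?_
    have := absNorm_span_two_of_sq_eq_sub_six h2 hω'
    simp [h0] at this
  have hd := orderOf_dvd_of_pow_eq_one ((ClassGroup.mk0_pow_eq_one_iff ⟨_, hI⟩ 2).mpr hsq)
  rw [orderOf_mk0_span_two_of_sq_eq_sub_six h2 hω' hI] at hd
  norm_num at hd

theorem not_isPrincipal_of_absNorm_eq_eight (hθ : θ ^ 2 = -5) {I : Ideal (𝓞 K)}
    (hI : Ideal.absNorm I = 8) : ¬ I.IsPrincipal := by
  intro hp
  have hd : ¬ IsSquare ((-5 : ℤ) : ℚ) := fun hs => by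
    have := hs.nonneg
    norm_num at this
  have hα : (θ : K) ^ 2 = algebraMap ℚ K (-5 : ℤ) := by
    simpa [map_ofNat] using congrArg (algebraMap (𝓞 K) K) hθ
  have h2 := finrank_adjoin_of_sq_eq hα hd
  have hg : AdjoinSimple.gen ℚ (θ : K) ^ 2 = (-5 : ℤ) :=
    (algebraMap ℚ⟮(θ : K)⟯ K).injective <| by
      rw [map_pow, AdjoinSimple.algebraMap_gen, hα, map_intCast, map_intCast]
  obtain ⟨γ, hγ, -⟩ := exists_sq_eq_of_sq_eq hg
  obtain ⟨T, S, e⟩ := exists_of_isPrincipal h2 hγ hd (Ideal.IsPrincipal.relNorm hp)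
  have e : 5 * T ^ 2 + S ^ 2 = 160 := by
    rw [Ideal.absNorm_relNorm, hI, ← abs_neg,
      abs_of_nonneg (by nlinarith [sq_nonneg T, sq_nonneg S])] at e
    norm_num at e
    linarith
  have hT : T ≤ 5 := by nlinarith
  have hT' : -5 ≤ T := by nlinarith
  have hS : S ≤ 12 := by nlinarith
  have hS' : -12 ≤ S := by nlinarith
  interval_cases T <;> interval_cases S <;> omega

theorem classNumber_of_biquadratic (hK : finrank ℚ K = 4) (hθ : θ ^ 2 = -5)
    (hω : ω ^ 2 = ω - 6) : classNumber K = 6 := by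
  have hn := (absNorm_span_triple hK hθ hω).1
  have hA : Ideal.span {2, 1 + θ, ω} ∈ (Ideal (𝓞 K))⁰ :=
    mem_nonZeroDivisors_iff_ne_zero.mpr fun h0 => by simp [h0] at hn
  rw [classNumber_eq_orderOf (zpowers_mk0_span_triple_eq_top hK hθ hω hA)]
  have h6 : (ClassGroup.mk0 ⟨_, hA⟩) ^ 6 = 1 := by
    rw [ClassGroup.mk0_pow_eq_one_iff]
    change (Ideal.span {2, 1 + θ, ω} ^ (2 * 3)).IsPrincipal
    rw [pow_mul, Ideal.span_triple_sq hθ hω, Ideal.span_two_pow_three hω]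
    exact ⟨_, rfl⟩
  have h2 : (ClassGroup.mk0 ⟨_, hA⟩) ^ 2 ≠ 1 := by
    rw [Ne, ClassGroup.mk0_pow_eq_one_iff]
    change ¬ (Ideal.span {2, 1 + θ, ω} ^ 2).IsPrincipal
    rw [Ideal.span_triple_sq hθ hω]
    exact not_isPrincipal_span_two_of_biquadratic hK hω
  have h3 : (ClassGroup.mk0 ⟨_, hA⟩) ^ 3 ≠ 1 := by
    rw [Ne, ClassGroup.mk0_pow_eq_one_iff]
    exact not_isPrincipal_of_absNorm_eq_eight hθ (by rw [map_pow]; exact congrArg (· ^ 3) hn)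
  refine orderOf_eq_of_pow_and_pow_div_prime (by norm_num) h6 fun p hp hp6 => ?_
  have hp' : p ≤ 6 := Nat.le_of_dvd (by norm_num) hp6
  have := hp.two_le
  interval_cases p <;> first | exact h3 | exact h2 | omega | norm_num at hp

end BiquadraticLowerBound

/-- The imaginary bicyclic biquadratic field `K = ℚ(√(-5), √(-23))` has class number
`6`, and its quadratic subfields `ℚ(√(-5))`, `ℚ(√(-23))`, `ℚ(√115)` have class numbers
`2`, `3`, `2` respectively. -/
theorem classNumber_sqrt_neg5_neg23 (K : Type) [Field K] [NumberField K]
    (hdeg : Module.finrank ℚ K = 4)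
    (hgen : ∃ α β : K, α ^ 2 = (-5 : K) ∧ β ^ 2 = (-23 : K))
    (K₁ K₂ K₃ : Type) [Field K₁] [NumberField K₁] [Field K₂] [NumberField K₂]
    [Field K₃] [NumberField K₃]
    (h₁ : Module.finrank ℚ K₁ = 2) (h₂ : Module.finrank ℚ K₂ = 2)
    (h₃ : Module.finrank ℚ K₃ = 2)
    (hg₁ : ∃ α : K₁, α ^ 2 = (-5 : K₁)) (hg₂ : ∃ α : K₂, α ^ 2 = (-23 : K₂))
    (hg₃ : ∃ α : K₃, α ^ 2 = (115 : K₃)) :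
    NumberField.classNumber K = 6 ∧ NumberField.classNumber K₁ = 2 ∧
      NumberField.classNumber K₂ = 3 ∧ NumberField.classNumber K₃ = 2 := by
  obtain ⟨α, β, hα, hβ⟩ := hgen
  obtain ⟨θ, hθ, -⟩ := exists_sq_eq_of_sq_eq (d := -5) (by simpa using hα)
  obtain ⟨ω, hω, -⟩ := exists_sq_eq_sub_six_of_sq_eq hβ
  obtain ⟨β₂, hβ₂⟩ := hg₂
  obtain ⟨ω₂, hω₂, -⟩ := exists_sq_eq_sub_six_of_sq_eq hβ₂
  exact ⟨classNumber_of_biquadratic hdeg (by simpa using hθ) hω,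
    classNumber_of_sq_eq_neg_five h₁ hg₁, classNumber_of_sq_eq_sub_six h₂ hω₂,
    classNumber_of_sq_eq_one_hundred_fifteen h₃ hg₃⟩
end
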